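/- arXiv:0909.4102 — 2 statements merged into one kernel-verified Lean document; each statement's English description precedes it below -/
import Mathlib

section
/- Let (A, m, k) be a Cohen–Macaulay local ring, and let M and N be nonzero finitely generated A-modules such that M has reducible complexity. Suppose Tor_n^A(M,N) = 0 for all n sufficiently large, and let q be the largest integer such that Tor_q^A(M,N) ≠ 0. If either (i) depth Tor_q^A(M,N) = 0, or (ii) q ≥ 1, depth Tor_q^A(M,N) ≤ 1 and the upper reducing degree of M is at least 2, then depth M + depth N = dim A + depth Tor_q^A(M,N) − q. -/
open IsLocalRing CategoryTheory

universe u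

noncomputable section

/-! Basic commutative-algebra notions: depth, minimal free resolutions, Betti numbers,
complexity, syzygies, reducible complexity, upper reducing degree, Tor-independence,
Gorenstein dimension, CI-dimension, Cohen-Macaulay local rings. -/




/-- The depth of a module over a local ring: the supremum of lengths of regular
sequences on the module consisting of elements of the maximal ideal. -/
def moduleDepth (A : Type u) [CommRing A] [IsLocalRing A]
    (M : Type u) [AddCommGroup M] [Module A M] : ℕ∞ :=
  sSup {n : ℕ∞ | ∃ rs : List A, (rs.length : ℕ∞) = n ∧
    (∀ x ∈ rs, x ∈ maximalIdeal A) ∧ RingTheory.Sequence.IsRegular M rs}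

/-- A minimal free resolution of a module over a local ring. -/
structure MinFreeRes (A : Type u) [CommRing A] [IsLocalRing A]
    (M : Type u) [AddCommGroup M] [Module A M] : Type (u + 1) where
  F : ℕ → ModuleCat.{u} A
  free : ∀ n, Module.Free A (F n)
  fin : ∀ n, Module.Finite A (F n)
  d : ∀ n, F (n + 1) →ₗ[A] F n
  aug : F 0 →ₗ[A] M
  aug_surj : Function.Surjective aug
  exact_aug : Function.Exact (d 0) aug
  exact_d : ∀ n, Function.Exact (d (n + 1)) (d n)
  minimal : ∀ n x, d n x ∈ (maximalIdeal A) • (⊤ : Submodule A (F n))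

/-- The Betti numbers of a minimal free resolution. -/
def MinFreeRes.betti {A : Type u} [CommRing A] [IsLocalRing A]
    {M : Type u} [AddCommGroup M] [Module A M] (R : MinFreeRes A M) (n : ℕ) : ℕ :=
  Module.finrank A (R.F n)

/-- The sequence `β` is eventually bounded by `a * n ^ (t - 1)` for some real `a`. -/
def CxBound (β : ℕ → ℕ) (t : ℕ) : Prop :=
  ∃ a : ℝ, ∃ N : ℕ, ∀ n, N ≤ n → (β n : ℝ) ≤ a * (n : ℝ) ^ ((t : ℝ) - 1)

/-- The complexity of a module: the least `t` such that the Betti sequence of a minimal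
free resolution is eventually bounded by `a * n ^ (t - 1)` for some `a` (and `⊤` if no
such `t` exists). -/
def complexity (A : Type u) [CommRing A] [IsLocalRing A]
    (M : Type u) [AddCommGroup M] [Module A M] : ℕ∞ :=
  sInf {t : ℕ∞ | ∃ t' : ℕ, t = (t' : ℕ∞) ∧ ∃ R : MinFreeRes A M, CxBound R.betti t'}

/-- A finite resolution of a module `M`:
an exact sequence `0 → G len → ⋯ → G 0 → M → 0`. -/
structure FinRes (A : Type u) [CommRing A]
    (M : Type u) [AddCommGroup M] [Module A M] : Type (u + 1) where
  len : ℕ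
  G : ℕ → ModuleCat.{u} A
  d : ∀ n, G (n + 1) →ₗ[A] G n
  aug : G 0 →ₗ[A] M
  bounded : ∀ n, len < n → Subsingleton (G n)
  aug_surj : Function.Surjective aug
  exact_aug : Function.Exact (d 0) aug
  exact_d : ∀ n, Function.Exact (d (n + 1)) (d n)

/-- A module has finite projective dimension if it admits a finite resolution by
projective modules. -/
def HasFiniteProjDim (A : Type u) [CommRing A]
    (M : Type u) [AddCommGroup M] [Module A M] : Prop :=
  ∃ R : FinRes A M, ∀ n, Module.Projective A (R.G n)

/-- `S` is an `n`-th syzygy of `M`: for `n = 0`, `S ≅ M`; for `n ≥ 1`, `S` is isomorphic to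
the image of the `n`-th differential in a minimal free resolution of `M`. -/
def IsSyzygy (A : Type u) [CommRing A] [IsLocalRing A]
    (M : Type u) [AddCommGroup M] [Module A M]
    (S : Type u) [AddCommGroup S] [Module A S] : ℕ → Prop
  | 0 => Nonempty (S ≃ₗ[A] M)
  | (n + 1) => ∃ R : MinFreeRes A M, Nonempty (S ≃ₗ[A] LinearMap.range (R.d n))

/-- `K` is obtained from `M` by a reduction of complexity coming from a cohomology class
of degree `t ≥ 1`, i.e. there is a short exact sequence `0 → M → K → Ω^{t-1}(M) → 0`. -/
def ReducesWithDeg (A : Type u) [CommRing A] [IsLocalRing A]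
    (M K : ModuleCat.{u} A) (t : ℕ) : Prop :=
  1 ≤ t ∧ ∃ (S : Type u) (_ : AddCommGroup S) (_ : Module A S),
    IsSyzygy A M S (t - 1) ∧
    ∃ (f : M →ₗ[A] K) (g : K →ₗ[A] S),
      Function.Injective f ∧ Function.Surjective g ∧ Function.Exact f g

/-- The class of (bundled) modules having reducible complexity: the smallest class
containing all modules of finite projective dimension, and containing every module `M` of
finite positive complexity admitting a short exact sequence
`0 → M → K → Ω^{t-1}(M) → 0` (coming from a degree-`t` self-extension) with
`cx K < cx M` and `K` of reducible complexity. -/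
inductive HasRedCxCat (A : Type u) [CommRing A] [IsLocalRing A] : ModuleCat.{u} A → Prop
  | of_finite_pd (M : ModuleCat.{u} A) : HasFiniteProjDim A M → HasRedCxCat A M
  | of_step (M K : ModuleCat.{u} A) (t : ℕ) :
      complexity A M ≠ 0 → complexity A M ≠ ⊤ →
      ReducesWithDeg A M K t →
      complexity A K < complexity A M →
      HasRedCxCat A K → HasRedCxCat A M

/-- A module has reducible complexity. -/
def HasReducibleComplexity (A : Type u) [CommRing A] [IsLocalRing A]
    (M : Type u) [AddCommGroup M] [Module A M] : Prop :=
  HasRedCxCat A (ModuleCat.of A M)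

/-- A sequence of short exact sequences `0 → K_{i-1} → K_i → Ω^{d_i - 1}(K_{i-1}) → 0`
with strictly decreasing complexities, ending in a module of complexity zero, i.e. a
sequence reducing the complexity of `Ks 0`. -/
def IsReducingSeq (A : Type u) [CommRing A] [IsLocalRing A] (t : ℕ)
    (Ks : Fin (t + 1) → ModuleCat.{u} A) (degs : Fin t → ℕ) : Prop :=
  (∀ i : Fin t, ReducesWithDeg A (Ks i.castSucc) (Ks i.succ) (degs i)) ∧
  (∀ i : Fin t, complexity A (Ks i.succ) < complexity A (Ks i.castSucc)) ∧
  complexity A (Ks (Fin.last t)) = 0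

open Classical in
/-- The upper reducing degree of `M`: `⊤` if `M` has finite projective dimension, and
otherwise the supremum, over all sequences reducing the complexity of `M`, of the minimum
of the degrees of the cohomology classes involved. -/
def upperReducingDegree (A : Type u) [CommRing A] [IsLocalRing A]
    (M : Type u) [AddCommGroup M] [Module A M] : ℕ∞ :=
  if HasFiniteProjDim A M then ⊤
  else sSup {r : ℕ∞ | ∃ (t : ℕ) (Ks : Fin (t + 1) → ModuleCat.{u} A) (degs : Fin t → ℕ),
    Ks 0 = ModuleCat.of A M ∧ IsReducingSeq A t Ks degs ∧
    r = ⨅ i : Fin t, (degs i : ℕ∞)}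

/-- The `n`-th Tor module of two modules. -/
def torModule (A : Type u) [CommRing A] (M N : Type u)
    [AddCommGroup M] [Module A M] [AddCommGroup N] [Module A N] (n : ℕ) : ModuleCat.{u} A :=
  ((Tor (ModuleCat.{u} A) n).obj (ModuleCat.of A M)).obj (ModuleCat.of A N)

/-- Two modules are Tor-independent if `Tor_n(M, N) = 0` for all `n > 0`. -/
def TorIndep (A : Type u) [CommRing A] (M N : Type u)
    [AddCommGroup M] [Module A M] [AddCommGroup N] [Module A N] : Prop :=
  ∀ n : ℕ, 0 < n → Subsingleton (torModule A M N n)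

/-- The `n`-th Ext module of two modules. -/
def extModule (A : Type u) [CommRing A] (M N : Type u)
    [AddCommGroup M] [Module A M] [AddCommGroup N] [Module A N] (n : ℕ) : ModuleCat.{u} A :=
  ((Ext A (ModuleCat.{u} A) n).obj (Opposite.op (ModuleCat.of A M))).obj (ModuleCat.of A N)

/-- A module `G` has Gorenstein dimension zero if it is reflexive and
`Ext^n(G, A) = 0 = Ext^n(Hom(G, A), A)` for all `n > 0`. -/
def GDimZero (A : Type u) [CommRing A] (G : Type u) [AddCommGroup G] [Module A G] : Prop :=
  Module.IsReflexive A G ∧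
  ∀ n : ℕ, 0 < n →
    Subsingleton (extModule A G A n) ∧ Subsingleton (extModule A (Module.Dual A G) A n)

/-- A module has finite Gorenstein dimension if it admits a finite resolution by modules
of Gorenstein dimension zero. -/
def HasFiniteGDim (A : Type u) [CommRing A]
    (M : Type u) [AddCommGroup M] [Module A M] : Prop :=
  ∃ R : FinRes A M, ∀ n, GDimZero A (R.G n)


/-- The Krull dimension of a ring, viewed in `WithBot ℕ∞`. -/
def ringKrullDimE (A : Type u) [CommRing A] : WithBot ℕ∞ := ringKrullDim A

/-- A local ring is Cohen-Macaulay if its depth equals its Krull dimension. -/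
def IsCMLocalRing (A : Type u) [CommRing A] [IsLocalRing A] : Prop :=
  (moduleDepth A A : WithBot ℕ∞) = ringKrullDimE A

/-- A module over a local ring is maximal Cohen-Macaulay if its depth equals the Krull
dimension of the ring. -/
def IsMaxCM (A : Type u) [CommRing A] [IsLocalRing A]
    (M : Type u) [AddCommGroup M] [Module A M] : Prop :=
  (moduleDepth A M : WithBot ℕ∞) = ringKrullDimE A

/-- A local ring is Gorenstein if and only if every finitely generated module over it has
finite Gorenstein dimension. -/
def IsGorensteinLocalRing (A : Type u) [CommRing A] [IsLocalRing A] : Prop :=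
  ∀ M : ModuleCat.{u} A, Module.Finite A M → HasFiniteGDim A M

/-- A module `M` over a local ring `A` has finite CI-dimension if there is a diagram of
local ring homomorphisms `A → R ← Q` with `A → R` flat and `Q → R` surjective with kernel
generated by a regular sequence, such that `R ⊗_A M` has finite projective dimension
over `Q`. -/
def HasFiniteCIDimMod (A : Type u) [CommRing A] [IsLocalRing A]
    (M : Type u) [AddCommGroup M] [Module A M] : Prop :=
  ∃ (R Q : Type u) (_ : CommRing R) (_ : CommRing Q) (_ : IsLocalRing R) (_ : IsLocalRing Q)
    (f : A →+* R) (g : Q →+* R),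
    IsLocalHom f ∧ IsLocalHom g ∧ Function.Surjective g ∧
    (∃ rs : List Q, RingTheory.Sequence.IsRegular Q rs ∧
      RingHom.ker g = Ideal.span {x | x ∈ rs}) ∧
    (letI : Algebra A R := f.toAlgebra
     Module.Flat A R ∧
     (letI : Module Q (TensorProduct A R M) := Module.compHom _ g
      HasFiniteProjDim Q (TensorProduct A R M)))

section TorSequence

open MonoidalCategory

lemma CategoryTheory.ProjectiveResolution.isIso_fromLeftDerivedZero'_of_preservesFiniteColimits
    {C D : Type*} [Category* C] [Category* D] [Abelian C] [Abelian D] {X : C}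
    (P : ProjectiveResolution X) (F : C ⥤ D) [F.Additive]
    (_ : Limits.PreservesFiniteColimits F) : IsIso (P.fromLeftDerivedZero' F) :=
  inferInstance

lemma CategoryTheory.ProjectiveResolution.fromLeftDerivedZero'_naturality_functor
    {C D : Type*} [Category* C] [Category* D] [Abelian C] [Abelian D]
    {X : C} (P : ProjectiveResolution X) {F G : C ⥤ D} [F.Additive] [G.Additive] (α : F ⟶ G) :
    HomologicalComplex.opcyclesMap ((NatTrans.mapHomologicalComplex α _).app P.complex) 0 ≫
      P.fromLeftDerivedZero' G = P.fromLeftDerivedZero' F ≫ α.app X := by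
  rw [← cancel_epi (HomologicalComplex.pOpcycles _ _),
    HomologicalComplex.p_opcyclesMap_assoc, P.pOpcycles_comp_fromLeftDerivedZero' G,
    P.pOpcycles_comp_fromLeftDerivedZero'_assoc F]
  exact (α.naturality _).symm

variable {A : Type u} [CommRing A]

/-- The functor sending `M` to `M ⊗ P`, with `P` the chosen projective resolution of `N`. -/
def tensorResolution (N : ModuleCat.{u} A) :
    ModuleCat.{u} A ⥤ ChainComplex (ModuleCat.{u} A) ℕ where
  obj M := (((tensoringLeft (ModuleCat.{u} A)).obj M).mapHomologicalComplex _).obj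
    (projectiveResolution N).complex
  map f := (NatTrans.mapHomologicalComplex ((tensoringLeft (ModuleCat.{u} A)).map f) _).app
    (projectiveResolution N).complex

/-- `Tor` is computed by the chosen projective resolution. -/
def torIsoHomology (M N : ModuleCat.{u} A) (n : ℕ) :
    ((Tor (ModuleCat.{u} A) n).obj M).obj N ≅ ((tensorResolution N).obj M).homology n :=
  (projectiveResolution N).isoLeftDerivedObj ((tensoringLeft (ModuleCat.{u} A)).obj M) n

lemma isIso_fromLeftDerivedZero'_tensor (M N : ModuleCat.{u} A) :
    IsIso ((projectiveResolution N).fromLeftDerivedZero'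
      ((tensoringLeft (ModuleCat.{u} A)).obj M)) :=
  ProjectiveResolution.isIso_fromLeftDerivedZero'_of_preservesFiniteColimits _ _
    (inferInstanceAs (Limits.PreservesFiniteColimits (tensorLeft M)))

/-- The degree zero homology of `M ⊗ P` is `M ⊗ N`. -/
def tensorResolutionHomologyZeroIso (M N : ModuleCat.{u} A) :
    ((tensorResolution N).obj M).homology 0 ≅ M ⊗ N :=
  (ChainComplex.isoHomologyι₀ _) ≪≫
    @asIso _ _ _ _ _ (isIso_fromLeftDerivedZero'_tensor M N)

lemma tensorResolutionHomologyZeroIso_naturality {M M' : ModuleCat.{u} A} (f : M ⟶ M')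
    (N : ModuleCat.{u} A) :
    HomologicalComplex.homologyMap ((tensorResolution N).map f) 0 ≫
      (tensorResolutionHomologyZeroIso M' N).hom =
    (tensorResolutionHomologyZeroIso M N).hom ≫ f ▷ N := by
  have h := (projectiveResolution N).fromLeftDerivedZero'_naturality_functor
    ((tensoringLeft (ModuleCat.{u} A)).map f)
  have h2 := HomologicalComplex.homologyι_naturality ((tensorResolution N).map f) 0
  let ι (L : ModuleCat.{u} A) := HomologicalComplex.homologyι ((tensorResolution N).obj L) 0
  let p (L : ModuleCat.{u} A) : ((tensorResolution N).obj L).opcycles 0 ⟶ L ⊗ N :=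
    (projectiveResolution N).fromLeftDerivedZero' ((tensoringLeft (ModuleCat.{u} A)).obj L)
  replace h : HomologicalComplex.opcyclesMap ((tensorResolution N).map f) 0 ≫ p M' =
    p M ≫ f ▷ N := h
  replace h2 : HomologicalComplex.homologyMap ((tensorResolution N).map f) 0 ≫ ι M' =
    ι M ≫ HomologicalComplex.opcyclesMap ((tensorResolution N).map f) 0 := h2
  change _ ≫ ι M' ≫ p M' = (ι M ≫ p M) ≫ f ▷ N
  rw [reassoc_of% h2, h, Category.assoc]

lemma tensorResolution_map_zero (N M M' : ModuleCat.{u} A) :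
    (tensorResolution N).map (0 : M ⟶ M') = 0 := by
  ext n : 1
  change (0 : M ⟶ M') ▷ _ = 0
  simp

instance (N : ModuleCat.{u} A) : (tensorResolution N).PreservesZeroMorphisms where
  map_zero X Y := tensorResolution_map_zero N X Y

instance (N : ModuleCat.{u} A) (n : ℕ) : Module.Flat A ((projectiveResolution N).complex.X n) := by
  have := (projectiveResolution N).projective n
  have : Module.Projective A ((projectiveResolution N).complex.X n) :=
    (IsProjective.iff_projective _).mpr this
  infer_instance

lemma ModuleCat.shortExact_of_function {S : ShortComplex (ModuleCat.{u} A)}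
    (h1 : Function.Injective S.f) (h2 : Function.Exact S.f S.g) (h3 : Function.Surjective S.g) :
    S.ShortExact where
  exact := (ShortComplex.ShortExact.moduleCat_exact_iff_function_exact S).mpr h2
  mono_f := (ModuleCat.mono_iff_injective _).mpr h1
  epi_g := (ModuleCat.epi_iff_surjective _).mpr h3

lemma tensorResolution_shortExact {S : ShortComplex (ModuleCat.{u} A)} (hS : S.ShortExact)
    (N : ModuleCat.{u} A) : (S.map (tensorResolution N)).ShortExact := by
  apply HomologicalComplex.shortExact_of_degreewise_shortExact
  intro n
  have hex := (ShortComplex.ShortExact.moduleCat_exact_iff_function_exact S).mp hS.exact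
  refine ModuleCat.shortExact_of_function ?_ ?_ ?_
  · exact Module.Flat.rTensor_preserves_injective_linearMap
      (M := (projectiveResolution N).complex.X n) S.f.hom hS.moduleCat_injective_f
  · exact Module.Flat.rTensor_exact ((projectiveResolution N).complex.X n) hex
  · exact LinearMap.rTensor_surjective _ hS.moduleCat_surjective_g

lemma subsingleton_homology_tensorResolution_of_flat (F N : ModuleCat.{u} A) [Module.Flat A F]
    (n : ℕ) : Subsingleton (((tensorResolution N).obj F).homology (n + 1)) := by
  have h := (projectiveResolution N).complex_exactAt_succ n
  rw [HomologicalComplex.exactAt_iff' _ (n + 1 + 1) (n + 1) n (by simp) (by simp)] at h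
  have h' := (ShortComplex.ShortExact.moduleCat_exact_iff_function_exact _).mp h
  have h2 : (((tensorResolution N).obj F)).ExactAt (n + 1) := by
    rw [HomologicalComplex.exactAt_iff' _ (n + 1 + 1) (n + 1) n (by simp) (by simp)]
    exact (ShortComplex.ShortExact.moduleCat_exact_iff_function_exact _).mpr
      (Module.Flat.lTensor_exact F h')
  exact ModuleCat.subsingleton_of_isZero h2.isZero_homology

lemma LinearEquiv.exact_conj {X₁ X₂ X₃ Y₁ Y₂ Y₃ : Type*} [AddCommGroup X₁] [AddCommGroup X₂]
    [AddCommGroup X₃] [AddCommGroup Y₁] [AddCommGroup Y₂] [AddCommGroup Y₃] [Module A X₁]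
    [Module A X₂] [Module A X₃] [Module A Y₁] [Module A Y₂] [Module A Y₃]
    (e₁ : X₁ ≃ₗ[A] Y₁) (e₂ : X₂ ≃ₗ[A] Y₂) (e₃ : X₃ ≃ₗ[A] Y₃) {f : Y₁ →ₗ[A] Y₂}
    {g : Y₂ →ₗ[A] Y₃} (h : Function.Exact f g) :
    Function.Exact (e₂.symm.toLinearMap ∘ₗ f ∘ₗ e₁.toLinearMap)
      (e₃.symm.toLinearMap ∘ₗ g ∘ₗ e₂.toLinearMap) :=
  Function.Exact.of_ladder_linearEquiv_of_exact (e₁ := e₁.symm) (e₂ := e₂.symm) (e₃ := e₃.symm)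
    (by ext; simp) (by ext; simp) h

open TensorProduct in
/-- The long exact sequence of `Tor` in the first variable. -/
lemma torModule_long_exact {M' M M'' : Type u} [AddCommGroup M'] [AddCommGroup M]
    [AddCommGroup M''] [Module A M'] [Module A M] [Module A M''] (N : Type u) [AddCommGroup N]
    [Module A N] {f : M' →ₗ[A] M} {g : M →ₗ[A] M''} (hf : Function.Injective f)
    (hfg : Function.Exact f g) (hg : Function.Surjective g) :
    ∃ (F : ∀ n, torModule A M' N n →ₗ[A] torModule A M N n)
      (G : ∀ n, torModule A M N n →ₗ[A] torModule A M'' N n)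
      (δ : ∀ n, torModule A M'' N (n + 1) →ₗ[A] torModule A M' N n)
      (e' : torModule A M' N 0 ≃ₗ[A] M' ⊗[A] N)
      (e : torModule A M N 0 ≃ₗ[A] M ⊗[A] N),
      (∀ n, Function.Exact (F n) (G n)) ∧ (∀ n, Function.Exact (G (n + 1)) (δ n)) ∧
        (∀ n, Function.Exact (δ n) (F n)) ∧
        e.toLinearMap ∘ₗ F 0 = f.rTensor N ∘ₗ e'.toLinearMap := by
  let S : ShortComplex (ModuleCat.{u} A) := ShortComplex.mk (ModuleCat.ofHom f) (ModuleCat.ofHom g)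
    (by ext x; exact hfg.apply_apply_eq_zero x)
  have hS : S.ShortExact := ModuleCat.shortExact_of_function hf hfg hg
  let N' := ModuleCat.of A N
  have hT := tensorResolution_shortExact hS N'
  let φ (L : ModuleCat.{u} A) (n : ℕ) :
      torModule A L N n ≃ₗ[A] ((tensorResolution N').obj L).homology n :=
    (torIsoHomology L N' n).toLinearEquiv
  let HF n := (HomologicalComplex.homologyMap ((tensorResolution N').map S.f) n).hom
  let HG n := (HomologicalComplex.homologyMap ((tensorResolution N').map S.g) n).hom
  let Hδ n := (hT.δ (n + 1) n rfl).hom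
  have h1 n : Function.Exact (HF n) (HG n) :=
    (ShortComplex.ShortExact.moduleCat_exact_iff_function_exact _).mp (hT.homology_exact₂ n)
  have h2 n : Function.Exact (HG (n + 1)) (Hδ n) :=
    (ShortComplex.ShortExact.moduleCat_exact_iff_function_exact _).mp
      (hT.homology_exact₃ (n + 1) n rfl)
  have h3 n : Function.Exact (Hδ n) (HF n) :=
    (ShortComplex.ShortExact.moduleCat_exact_iff_function_exact _).mp
      (hT.homology_exact₁ (n + 1) n rfl)
  let ε (L : ModuleCat.{u} A) := (tensorResolutionHomologyZeroIso L N').toLinearEquiv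
  refine ⟨fun n => (φ S.X₂ n).symm.toLinearMap ∘ₗ HF n ∘ₗ (φ S.X₁ n).toLinearMap,
    fun n => (φ S.X₃ n).symm.toLinearMap ∘ₗ HG n ∘ₗ (φ S.X₂ n).toLinearMap,
    fun n => (φ S.X₁ n).symm.toLinearMap ∘ₗ Hδ n ∘ₗ (φ S.X₃ (n + 1)).toLinearMap,
    (φ S.X₁ 0).trans (ε S.X₁), (φ S.X₂ 0).trans (ε S.X₂), fun n => ?_, fun n => ?_,
    fun n => ?_, ?_⟩
  · exact LinearEquiv.exact_conj (φ S.X₁ n) (φ S.X₂ n) (φ S.X₃ n) (h1 n)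
  · exact LinearEquiv.exact_conj (φ S.X₂ (n + 1)) (φ S.X₃ (n + 1)) (φ S.X₁ n) (h2 n)
  · exact LinearEquiv.exact_conj (φ S.X₃ (n + 1)) (φ S.X₁ n) (φ S.X₂ n) (h3 n)
  · have := congrArg ModuleCat.Hom.hom (tensorResolutionHomologyZeroIso_naturality S.f N')
    ext x
    have h4 := LinearMap.congr_fun this (φ S.X₁ 0 x)
    simp only [LinearMap.comp_apply, LinearEquiv.coe_coe, LinearEquiv.trans_apply,
      LinearEquiv.apply_symm_apply]
    exact h4

lemma torModule_succ_subsingleton_of_flat (F N : Type u) [AddCommGroup F] [Module A F]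
    [AddCommGroup N] [Module A N] [Module.Flat A F] (n : ℕ) :
    Subsingleton (torModule A F N (n + 1)) :=
  have := subsingleton_homology_tensorResolution_of_flat (ModuleCat.of A F) (ModuleCat.of A N) n
  (torIsoHomology (ModuleCat.of A F) (ModuleCat.of A N) (n + 1)).toLinearEquiv.toEquiv.subsingleton

/-- `Tor_0(M, N)` is `M ⊗ N`. -/
lemma nonempty_torModule_zero_equiv (M N : Type u) [AddCommGroup M] [Module A M]
    [AddCommGroup N] [Module A N] : Nonempty (torModule A M N 0 ≃ₗ[A] TensorProduct A M N) :=
  ⟨(torIsoHomology (ModuleCat.of A M) (ModuleCat.of A N) 0 ≪≫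
    tensorResolutionHomologyZeroIso _ _).toLinearEquiv⟩

lemma nonempty_torModule_equiv_of_equiv {M M' : Type u} (N : Type u) [AddCommGroup M] [Module A M]
    [AddCommGroup M'] [Module A M'] [AddCommGroup N] [Module A N] (e : M ≃ₗ[A] M') (n : ℕ) :
    Nonempty (torModule A M N n ≃ₗ[A] torModule A M' N n) :=
  ⟨(((Tor (ModuleCat.{u} A) n).mapIso e.toModuleIso).app (ModuleCat.of A N)).toLinearEquiv⟩

section Syzygy

variable {K F M : Type u} [AddCommGroup K] [AddCommGroup F] [AddCommGroup M]
  [Module A K] [Module A F] [Module A M] [Module.Flat A F] (N : Type u) [AddCommGroup N]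
  [Module A N] {f : K →ₗ[A] F} {g : F →ₗ[A] M}

lemma nonempty_torModule_succ_succ_equiv (hf : Function.Injective f)
    (hfg : Function.Exact f g) (hg : Function.Surjective g) (n : ℕ) :
    Nonempty (torModule A M N (n + 2) ≃ₗ[A] torModule A K N (n + 1)) := by
  obtain ⟨F', G, δ, -, -, h1, h2, h3, -⟩ := torModule_long_exact N hf hfg hg
  have i1 := torModule_succ_subsingleton_of_flat (A := A) F N (n + 1)
  have i2 := torModule_succ_subsingleton_of_flat (A := A) F N n
  refine ⟨LinearEquiv.ofBijective (δ (n + 1)) ⟨?_, ?_⟩⟩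
  · rw [injective_iff_map_eq_zero]
    intro x hx
    obtain ⟨y, rfl⟩ := (h2 (n + 1) x).mp hx
    rw [Subsingleton.elim y 0, map_zero]
  · intro x
    exact (h3 (n + 1) x).mp (Subsingleton.elim _ _)

open TensorProduct in
lemma exists_torModule_one_exact (hf : Function.Injective f)
    (hfg : Function.Exact f g) (hg : Function.Surjective g) :
    ∃ d : torModule A M N 1 →ₗ[A] K ⊗[A] N, Function.Injective d ∧
      Function.Exact d (f.rTensor N) := by
  obtain ⟨F', G, δ, e', e, h1, h2, h3, h4⟩ := torModule_long_exact N hf hfg hg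
  have i1 := torModule_succ_subsingleton_of_flat (A := A) F N 0
  refine ⟨e'.toLinearMap ∘ₗ δ 0, ?_, ?_⟩
  · rw [injective_iff_map_eq_zero]
    intro x hx
    obtain ⟨y, rfl⟩ := (h2 0 x).mp (by simpa using hx)
    rw [Subsingleton.elim y 0, map_zero]
  · refine Function.Exact.of_ladder_linearEquiv_of_exact (e₁ := .refl A _) (e₂ := e')
      (e₃ := e) (by ext; simp) ?_ (h3 0)
    exact h4.symm

end Syzygy

end TorSequence

section ResidueExt

open Abelian

variable (A : Type u) [CommRing A] [IsLocalRing A]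

/-- The module `Ext^i(k, X)`, with `k` the residue field of `A`. -/
abbrev ResidueExt (X : Type u) [AddCommGroup X] [Module A X] (i : ℕ) : Type u :=
  Ext.{u} (ModuleCat.of A (ResidueField A)) (ModuleCat.of A X) i

variable {A} {X Y Z : Type u} [AddCommGroup X] [Module A X] [AddCommGroup Y] [Module A Y]
  [AddCommGroup Z] [Module A Z]

/-- The map induced on `Ext^i(k, -)` by a linear map. -/
def ResidueExt.map (f : X →ₗ[A] Y) (i : ℕ) : ResidueExt A X i →ₗ[A] ResidueExt A Y i where
  toFun x := x.comp (Ext.mk₀ (ModuleCat.ofHom f)) (add_zero i)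
  map_add' _ _ := Ext.add_comp ..
  map_smul' _ _ := Ext.smul_comp ..

lemma ResidueExt.map_apply (f : X →ₗ[A] Y) (i : ℕ) (x : ResidueExt A X i) :
    map f i x = x.comp (Ext.mk₀ (ModuleCat.ofHom f)) (add_zero i) := rfl

@[simp]
lemma ResidueExt.map_id (i : ℕ) : map (LinearMap.id : X →ₗ[A] X) i = LinearMap.id := by
  ext x
  exact Ext.comp_mk₀_id x

lemma ResidueExt.map_comp (g : Y →ₗ[A] Z) (f : X →ₗ[A] Y) (i : ℕ) :
    map (g ∘ₗ f) i = map g i ∘ₗ map f i := by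
  ext x
  simp [map_apply, ModuleCat.ofHom_comp, ← Ext.mk₀_comp_mk₀]

lemma ResidueExt.map_add (f g : X →ₗ[A] Y) (i : ℕ) : map (f + g) i = map f i + map g i := by
  ext x
  simp only [map_apply, ModuleCat.ofHom_add, Ext.mk₀_add, LinearMap.add_apply]
  exact Ext.comp_add ..

lemma ResidueExt.map_smul (a : A) (f : X →ₗ[A] Y) (i : ℕ) : map (a • f) i = a • map f i := by
  ext x
  have : ModuleCat.ofHom (a • f) = a • ModuleCat.ofHom f := rfl
  simp [map_apply, this, Ext.mk₀_smul]

@[simp]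
lemma ResidueExt.map_zero (i : ℕ) : map (0 : X →ₗ[A] Y) i = 0 := by
  simpa using map_smul (0 : A) (0 : X →ₗ[A] Y) i

lemma ResidueExt.map_sum {ι : Type*} (s : Finset ι) (f : ι → X →ₗ[A] Y) (i : ℕ) :
    map (∑ b ∈ s, f b) i = ∑ b ∈ s, map (f b) i := by
  classical
  induction s using Finset.induction_on with
  | empty => simp
  | insert b s hb ih => rw [Finset.sum_insert hb, Finset.sum_insert hb, map_add, ih]

lemma ResidueExt.smul_eq_zero {a : A} (ha : a ∈ maximalIdeal A) {i : ℕ} (x : ResidueExt A X i) :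
    a • x = 0 := by
  have h : a • 𝟙 (ModuleCat.of A (ResidueField A)) = 0 := by
    ext y
    change a • (y : ResidueField A) = 0
    obtain ⟨y, rfl⟩ := residue_surjective y
    rw [Algebra.smul_def, ResidueField.algebraMap_eq, (residue_eq_zero_iff a).mpr ha, zero_mul]
  calc a • x = (Ext.mk₀ (a • 𝟙 _)).comp x (zero_add i) := by
        rw [Ext.mk₀_smul, Ext.smul_comp, Ext.mk₀_id_comp]
    _ = 0 := by rw [h, Ext.mk₀_zero, Ext.zero_comp]

lemma ResidueExt.map_eq_zero_of_mem_smul {f : X →ₗ[A] Y}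
    (hf : f ∈ maximalIdeal A • (⊤ : Submodule A (X →ₗ[A] Y))) (i : ℕ) : map f i = 0 := by
  induction hf using Submodule.smul_induction_on' with
  | smul a ha g _ => ext x; rw [map_smul]; exact smul_eq_zero ha _
  | add f _ g _ hf hg => rw [map_add, hf, hg, add_zero]

lemma ResidueExt.map_zero_injective {f : X →ₗ[A] Y} (hf : Function.Injective f) :
    Function.Injective (map f 0) :=
  have : Mono (ModuleCat.ofHom f) := (ModuleCat.mono_iff_injective _).mpr hf
  Ext.postcomp_mk₀_injective_of_mono _ (ModuleCat.ofHom f)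

/-- The long exact sequence of `Ext(k, -)`. -/
lemma ResidueExt.long_exact {f : X →ₗ[A] Y} {g : Y →ₗ[A] Z} (hf : Function.Injective f)
    (hfg : Function.Exact f g) (hg : Function.Surjective g) :
    ∃ δ : ∀ n, ResidueExt A Z n → ResidueExt A X (n + 1),
      (∀ n, Function.Exact (map f n) (map g n)) ∧ (∀ n, Function.Exact (map g n) (δ n)) ∧
        (∀ n, Function.Exact (δ n) (map f (n + 1))) := by
  let S : ShortComplex (ModuleCat.{u} A) := ShortComplex.mk (ModuleCat.ofHom f) (ModuleCat.ofHom g)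
    (by ext x; exact hfg.apply_apply_eq_zero x)
  have hS : S.ShortExact := ModuleCat.shortExact_of_function hf hfg hg
  refine ⟨fun n x => x.comp hS.extClass rfl, fun n y => ⟨?_, ?_⟩, fun n y => ⟨?_, ?_⟩,
    fun n y => ⟨?_, ?_⟩⟩
  · exact fun hy => Ext.covariant_sequence_exact₂ _ hS y hy
  · rintro ⟨x, rfl⟩
    rw [← LinearMap.comp_apply, ← map_comp, hfg.linearMap_comp_eq_zero]
    simp
  · exact fun hy => Ext.covariant_sequence_exact₃ _ hS y rfl hy
  · rintro ⟨x, rfl⟩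
    have := hS.comp_extClass
    change (x.comp (Ext.mk₀ S.g) (add_zero n)).comp hS.extClass rfl = 0
    rw [Ext.comp_assoc_of_second_deg_zero, hS.comp_extClass, Ext.comp_zero]
  · exact fun hy => Ext.covariant_sequence_exact₁ _ hS y hy rfl
  · rintro ⟨x, rfl⟩
    change (x.comp hS.extClass rfl).comp (Ext.mk₀ S.f) (add_zero _) = 0
    rw [Ext.comp_assoc_of_third_deg_zero, hS.extClass_comp, Ext.comp_zero]

lemma ResidueExt.subsingleton_of_equiv (e : X ≃ₗ[A] Y) {i : ℕ}
    (h : Subsingleton (ResidueExt A Y i)) :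
    Subsingleton (ResidueExt A X i) := by
  have : Function.Injective (map e.toLinearMap i) := by
    refine Function.LeftInverse.injective (g := map e.symm.toLinearMap i) fun x => ?_
    rw [← LinearMap.comp_apply, ← map_comp]
    simp
  exact this.subsingleton

variable (X) in
lemma ResidueExt.subsingleton_of_subsingleton [Subsingleton X] {i : ℕ} :
    Subsingleton (ResidueExt A X i) := by
  refine subsingleton_of_forall_eq 0 fun x => ?_
  have : map (LinearMap.id : X →ₗ[A] X) i x = 0 := by
    rw [Subsingleton.elim LinearMap.id 0, map_zero, LinearMap.zero_apply]
  rwa [map_id, LinearMap.id_apply] at this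

variable (A X) in
/-- `Ext^i(k, X)` is nonzero for `i = n`, and zero for `i < n`. -/
def HasExtDepth (n : ℕ) : Prop :=
  (∀ i < n, Subsingleton (ResidueExt A X i)) ∧ ¬ Subsingleton (ResidueExt A X n)

lemma HasExtDepth.unique {m n : ℕ} (hm : HasExtDepth A X m) (hn : HasExtDepth A X n) : m = n := by
  rcases lt_trichotomy m n with h | h | h
  · exact (hm.2 (hn.1 m h)).elim
  · exact h
  · exact (hn.2 (hm.1 n h)).elim

lemma HasExtDepth.of_equiv (e : X ≃ₗ[A] Y) {n : ℕ} (h : HasExtDepth A X n) : HasExtDepth A Y n :=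
  ⟨fun i hi => ResidueExt.subsingleton_of_equiv e.symm (h.1 i hi),
    fun h' => h.2 (ResidueExt.subsingleton_of_equiv e h')⟩

variable [IsNoetherianRing A]

lemma exists_isRegular_iff_subsingleton_residueExt [Module.Finite A X] [Nontrivial X] (n : ℕ) :
    (∃ rs : List A, rs.length = n ∧ (∀ r ∈ rs, r ∈ maximalIdeal A) ∧
      RingTheory.Sequence.IsRegular X rs) ↔ ∀ i < n, Subsingleton (ResidueExt A X i) := by
  have hlt : maximalIdeal A • (⊤ : Submodule A X) < ⊤ := by
    rw [lt_top_iff_ne_top]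
    exact (Submodule.top_ne_ideal_smul_of_le_jacobson_annihilator
      (maximalIdeal_le_jacobson _)).symm
  have hsupp : Module.support A (ResidueField A) = PrimeSpectrum.zeroLocus (maximalIdeal A) := by
    rw [Module.support_eq_zeroLocus]
    congr
    exact Ideal.annihilator_quotient
  constructor
  · rintro ⟨rs, rfl, h1, h2⟩
    exact ModuleCat.subsingleton_ext_of_exists_isRegular (maximalIdeal A)
      (ModuleCat.of A (ResidueField A)) hsupp.subset (ModuleCat.of A X) hlt rs h1 h2
  · exact ModuleCat.exists_isRegular_of_exists_subsingleton_ext (maximalIdeal A) n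
      (ModuleCat.of A X) hlt (ModuleCat.of A (ResidueField A)) hsupp

variable (A X) in
lemma exists_moduleDepth_eq [Module.Finite A X] [Nontrivial X] :
    ∃ n : ℕ, moduleDepth A X = n ∧ HasExtDepth A X n ∧ (n : WithBot ℕ∞) ≤ ringKrullDim A := by
  obtain ⟨D, hD⟩ : ∃ D : ℕ, ringKrullDim A = D := by
    obtain ⟨d, hd⟩ := WithBot.ne_bot_iff_exists.mp (ringKrullDim_ne_bot (R := A))
    have : d ≠ ⊤ := by
      rintro rfl
      exact (ringKrullDim_lt_top (R := A)).ne hd.symm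
    obtain ⟨m, rfl⟩ := ENat.ne_top_iff_exists.mp this
    exact ⟨m, hd.symm⟩
  have hle (n : ℕ) (hn : ∀ i < n, Subsingleton (ResidueExt A X i)) : n ≤ D := by
    obtain ⟨rs, rfl, h1, h2⟩ := (exists_isRegular_iff_subsingleton_residueExt n).mpr hn
    have h3 := Module.supportDim_add_length_eq_supportDim_of_isRegular rs h2
    have h4 := (Module.supportDim_le_ringKrullDim A X)
    have : Nontrivial (X ⧸ Ideal.ofList rs • (⊤ : Submodule A X)) :=
      Submodule.Quotient.nontrivial_iff.mpr h2.top_ne_smul.symm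
    rw [← h3, hD] at h4
    have h5 : (0 : WithBot ℕ∞) ≤
        Module.supportDim A (X ⧸ Ideal.ofList rs • (⊤ : Submodule A X)) := by
      have := Module.supportDim_ne_bot_of_nontrivial A (X ⧸ Ideal.ofList rs • (⊤ : Submodule A X))
      obtain ⟨d, hd⟩ := WithBot.ne_bot_iff_exists.mp this
      rw [← hd]
      exact_mod_cast zero_le
    have h6 := (le_add_of_nonneg_left h5).trans h4
    exact_mod_cast h6
  classical
  have hex : ∃ n, ¬ Subsingleton (ResidueExt A X n) := by
    by_contra! h
    exact absurd (hle (D + 1) fun i _ => h i) (by lia)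
  obtain ⟨n, hn⟩ : ∃ n, HasExtDepth A X n :=
    ⟨Nat.find hex, fun i hi => not_not.mp (Nat.find_min hex hi), Nat.find_spec hex⟩
  refine ⟨n, le_antisymm (sSup_le ?_) (le_sSup ?_), hn, ?_⟩
  · rintro _ ⟨rs, rfl, h⟩
    have := (exists_isRegular_iff_subsingleton_residueExt rs.length).mp ⟨rs, rfl, h⟩
    by_contra! hlt
    exact hn.2 (this n (by exact_mod_cast hlt))
  · obtain ⟨rs, h1, h2⟩ := (exists_isRegular_iff_subsingleton_residueExt _).mpr hn.1
    exact ⟨rs, by rw [h1], h2⟩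
  · rw [hD]
    exact_mod_cast hle _ hn.1

end ResidueExt

section MinimalResolutions

open TensorProduct

variable {A : Type u} [CommRing A] [IsLocalRing A]

lemma LinearMap.mem_smul_top_of_forall_mem {R K F : Type*} [CommRing R] [AddCommGroup K]
    [Module R K] [AddCommGroup F] [Module R F] [Module.Free R K] [Module.Finite R K] (I : Ideal R)
    {φ : K →ₗ[R] F} (h : ∀ x, φ x ∈ I • (⊤ : Submodule R F)) :
    φ ∈ I • (⊤ : Submodule R (K →ₗ[R] F)) := by
  let b := Module.Free.chooseBasis R K
  have hφ : φ = ∑ i, (b.coord i).smulRight (φ (b i)) := by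
    refine b.ext fun j => ?_
    simp [LinearMap.sum_apply, Finsupp.single_apply, Finset.sum_ite_eq]
  rw [hφ]
  refine Submodule.sum_mem _ fun i _ => ?_
  have key : ∀ y ∈ I • (⊤ : Submodule R F),
      (b.coord i).smulRight y ∈ I • (⊤ : Submodule R (K →ₗ[R] F)) := by
    intro y hy
    induction hy using Submodule.smul_induction_on' with
    | smul a ha y _ =>
      have : (b.coord i).smulRight (a • y) = a • (b.coord i).smulRight y := by
        ext x
        exact smul_comm _ _ _
      rw [this]
      exact Submodule.smul_mem_smul ha trivial
    | add y _ z _ hy hz =>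
      have : (b.coord i).smulRight (y + z) = (b.coord i).smulRight y + (b.coord i).smulRight z := by
        ext x
        simp
      rw [this]
      exact add_mem hy hz
  exact key _ (h _)

lemma ResidueExt.map_rTensor_eq_zero {K F : Type u} [AddCommGroup K]
    [Module A K] [AddCommGroup F] [Module A F] [Module.Free A K] [Module.Finite A K]
    {φ : K →ₗ[A] F} (h : ∀ x, φ x ∈ maximalIdeal A • (⊤ : Submodule A F))
    (N : Type u) [AddCommGroup N] [Module A N] (i : ℕ) : map (φ.rTensor N) i = 0 := by
  have h1 := LinearMap.mem_smul_top_of_forall_mem _ h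
  refine map_eq_zero_of_mem_smul ?_ i
  have h2 := Submodule.mem_map_of_mem (f := LinearMap.rTensorHom N) h1
  rw [Submodule.map_smul''] at h2
  exact Submodule.smul_mono le_rfl le_top h2

lemma ResidueExt.subsingleton_free_tensor (F N : Type u) [AddCommGroup F] [Module A F]
    [AddCommGroup N] [Module A N] [Module.Free A F] [Module.Finite A F] {i : ℕ}
    (h : Subsingleton (ResidueExt A N i)) : Subsingleton (ResidueExt A (F ⊗[A] N) i) := by
  have h' : Subsingleton (ResidueExt A (A ⊗[A] N) i) :=
    subsingleton_of_equiv (TensorProduct.lid A N) h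
  let b := Module.Free.chooseBasis A F
  have hid : (LinearMap.id : F →ₗ[A] F) =
      ∑ j, LinearMap.toSpanSingleton A F (b j) ∘ₗ b.coord j := by
    ext x
    simp [LinearMap.sum_apply, b.sum_repr]
  have hid' : (LinearMap.id : F ⊗[A] N →ₗ[A] F ⊗[A] N) =
      ∑ j, (LinearMap.toSpanSingleton A F (b j)).rTensor N ∘ₗ (b.coord j).rTensor N := by
    rw [← LinearMap.rTensor_id, hid, ← LinearMap.coe_rTensorHom, _root_.map_sum]
    simp [LinearMap.rTensor_comp]
  refine subsingleton_of_forall_eq 0 fun x => ?_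
  have : map (LinearMap.id : F ⊗[A] N →ₗ[A] F ⊗[A] N) i x = 0 := by
    rw [hid', map_sum, LinearMap.sum_apply]
    refine Finset.sum_eq_zero fun j _ => ?_
    rw [map_comp, LinearMap.comp_apply, Subsingleton.elim (map _ i x) 0, _root_.map_zero]
  simpa using this

lemma HasExtDepth.free_tensor (F : Type u) {N : Type u} [AddCommGroup F] [Module A F]
    [AddCommGroup N] [Module A N] [Module.Free A F] [Module.Finite A F] [Nontrivial F] {n : ℕ}
    (h : HasExtDepth A N n) : HasExtDepth A (F ⊗[A] N) n := by
  refine ⟨fun i hi => ResidueExt.subsingleton_free_tensor F N (h.1 i hi), fun hs => ?_⟩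
  apply (h.of_equiv (TensorProduct.lid A N).symm).2
  let b := Module.Free.chooseBasis A F
  obtain ⟨j⟩ := b.index_nonempty
  have hid : b.coord j ∘ₗ LinearMap.toSpanSingleton A F (b j) = LinearMap.id := by
    ext
    simp
  have : Function.LeftInverse (ResidueExt.map ((b.coord j).rTensor N) n)
      (ResidueExt.map ((LinearMap.toSpanSingleton A F (b j)).rTensor N) n) := by
    intro x
    rw [← LinearMap.comp_apply, ← ResidueExt.map_comp, ← LinearMap.rTensor_comp, hid]
    simp
  exact this.injective.subsingleton

variable (A) in
/-- `M` is a nonzero module admitting a minimal resolution of length `p` by finite free modules. -/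
def HasMinFreeLength : ℕ → ∀ (M : Type u) [AddCommGroup M] [Module A M], Prop
  | 0, M, _, _ => Module.Free A M ∧ Module.Finite A M ∧ Nontrivial M
  | p + 1, M, _, _ => ∃ (F : Type u) (_ : AddCommGroup F) (_ : Module A F) (g : F →ₗ[A] M),
      Module.Free A F ∧ Module.Finite A F ∧ Nontrivial F ∧ Function.Surjective g ∧
        LinearMap.ker g ≤ maximalIdeal A • (⊤ : Submodule A F) ∧
        HasMinFreeLength p (LinearMap.ker g)

/-- For a minimal presentation `0 → K → F → M → 0`, the map `K ⊗ N → F ⊗ N` vanishes on the first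
nonzero `Ext(k, -)` of `K ⊗ N` if `K` has a minimal free resolution of length
`depth N - depth (K ⊗ N)`. -/
lemma ResidueExt.map_rTensor_subtype_eq_zero {F N : Type u} [AddCommGroup F] [Module A F]
    [AddCommGroup N] [Module A N] [Module.Free A F] [Module.Finite A F]
    {K : Submodule A F} (hK : K ≤ maximalIdeal A • (⊤ : Submodule A F)) {p s r : ℕ}
    (hp : HasMinFreeLength A p K) (hr : HasExtDepth A N r) (hs : s + p = r) :
    map (K.subtype.rTensor N) s = 0 := by
  cases p with
  | zero =>
    obtain ⟨_, _, _⟩ := hp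
    exact map_rTensor_eq_zero (fun x => hK x.2) N s
  | succ p =>
    have := subsingleton_free_tensor F N (hr.1 s (by lia))
    ext x
    exact Subsingleton.elim _ _

/-- If `M` has a minimal free resolution of length `p` and is Tor-independent of `N`, then
`depth (M ⊗ N) = depth N - p`. -/
lemma HasMinFreeLength.hasExtDepth_tensor {N : Type u} [AddCommGroup N] [Module A N] {r : ℕ}
    (hr : HasExtDepth A N r) {p : ℕ} {M : Type u} [AddCommGroup M] [Module A M]
    (hp : HasMinFreeLength A p M) (hT : TorIndep A M N) :
    ∃ s, s + p = r ∧ HasExtDepth A (M ⊗[A] N) s := by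
  induction p generalizing M with
  | zero =>
    obtain ⟨_, _, _⟩ := hp
    exact ⟨r, rfl, hr.free_tensor M⟩
  | succ p ih =>
    obtain ⟨F, _, _, g, _, _, _, hg, hK, hp⟩ := hp
    have hex : Function.Exact (LinearMap.ker g).subtype g := LinearMap.exact_subtype_ker_map g
    obtain ⟨s, hs, hsd⟩ := ih hp (by
      rintro (_ | n) hn
      · lia
      · obtain ⟨e⟩ := nonempty_torModule_succ_succ_equiv N (Submodule.subtype_injective _) hex hg n
        have := hT (n + 2) (by lia)
        exact e.symm.toEquiv.subsingleton)
    have hz := ResidueExt.map_rTensor_subtype_eq_zero hK hp hr hs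
    have hF := hr.free_tensor F
    have hinj : Function.Injective ((LinearMap.ker g).subtype.rTensor N) := by
      obtain ⟨d, -, hd⟩ := exists_torModule_one_exact N (Submodule.subtype_injective _) hex hg
      have := hT 1 one_pos
      rw [injective_iff_map_eq_zero]
      intro x hx
      obtain ⟨y, rfl⟩ := (hd x).mp hx
      rw [Subsingleton.elim y 0, map_zero]
    have hex' : Function.Exact ((LinearMap.ker g).subtype.rTensor N) (g.rTensor N) :=
      rTensor_exact N hex hg
    obtain ⟨δ, h1, h2, h3⟩ :=
      ResidueExt.long_exact hinj hex' (LinearMap.rTensor_surjective N hg)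
    cases s with
    | zero =>
      refine (hsd.2 ⟨fun x y => ResidueExt.map_zero_injective hinj ?_⟩).elim
      rw [hz, LinearMap.zero_apply, LinearMap.zero_apply]
    | succ s =>
      refine ⟨s, by lia, fun i hi => ?_, fun hs' => hsd.2 ?_⟩
      · have i1 := hF.1 i (by lia)
        have i2 := hsd.1 (i + 1) (by lia)
        refine subsingleton_of_forall_eq 0 fun x => ?_
        obtain ⟨y, rfl⟩ := (h2 i x).mp (Subsingleton.elim _ _)
        rw [Subsingleton.elim y 0, map_zero]
      · have : ∀ x, ∃ y, δ s y = x := fun x => (h3 s x).mp (by rw [hz]; rfl)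
        exact Function.Surjective.subsingleton (f := δ s) this

/-- The depth formula with `Tor` for modules of finite projective dimension. -/
lemma HasMinFreeLength.depth_formula {N : Type u} [AddCommGroup N] [Module A N] {e : ℕ}
    (he : HasExtDepth A N e) {p q τ : ℕ} {M : Type u} [AddCommGroup M] [Module A M]
    (hp : HasMinFreeLength A p M) (hv : ∀ n, q < n → Subsingleton (torModule A M N n))
    (hτ : HasExtDepth A (torModule A M N q) τ) (hc : τ = 0 ∨ 1 ≤ q ∧ τ = 1) :
    e + q = p + τ := by
  induction q generalizing M p with
  | zero =>
    obtain ⟨s, hs, hsd⟩ := hp.hasExtDepth_tensor he hv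
    obtain ⟨φ⟩ := nonempty_torModule_zero_equiv (A := A) M N
    have := hsd.unique (hτ.of_equiv φ)
    lia
  | succ q ih =>
    cases p with
    | zero =>
      obtain ⟨_, _, _⟩ := hp
      have := torModule_succ_subsingleton_of_flat (A := A) M N q
      exact (hτ.2 (ResidueExt.subsingleton_of_subsingleton _)).elim
    | succ p =>
      obtain ⟨F, _, _, g, _, _, _, hg, hK, hp⟩ := hp
      have hex : Function.Exact (LinearMap.ker g).subtype g := LinearMap.exact_subtype_ker_map g
      have hT : ∀ n, q < n → Subsingleton (torModule A (LinearMap.ker g) N n) := by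
        rintro (_ | n) hn
        · lia
        · obtain ⟨e⟩ :=
            nonempty_torModule_succ_succ_equiv N (Submodule.subtype_injective _) hex hg n
          have := hv (n + 2) (by lia)
          exact e.symm.toEquiv.subsingleton
      rcases q with _ | q
      · obtain ⟨s, hs, hsd⟩ := hp.hasExtDepth_tensor he hT
        have hz := ResidueExt.map_rTensor_subtype_eq_zero hK hp he hs
        have hF := he.free_tensor F
        obtain ⟨d, hdi, hd⟩ := exists_torModule_one_exact N (Submodule.subtype_injective _) hex hg
        set φ := (LinearMap.ker g).subtype.rTensor N with hφ
        have hd' : Function.Exact d φ.rangeRestrict := fun x => by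
          rw [← hd x, ← Subtype.val_inj]
          rfl
        obtain ⟨δ, h1, h2, h3⟩ :=
          ResidueExt.long_exact hdi hd' (LinearMap.surjective_rangeRestrict φ)
        have hC : Function.Injective (ResidueExt.map (LinearMap.range φ).subtype 0) :=
          ResidueExt.map_zero_injective (Submodule.subtype_injective _)
        rcases hc with rfl | ⟨-, rfl⟩
        · rcases s with _ | s
          · lia
          · have := hsd.1 0 (by lia)
            exact (hτ.2 (ResidueExt.map_zero_injective hdi).subsingleton).elim
        · rcases s with _ | _ | s
          · refine (hsd.2 ?_).elim
            have := hτ.1 0 one_pos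
            refine subsingleton_of_forall_eq 0 fun x => ?_
            obtain ⟨y, rfl⟩ := (h1 0 x).mp (hC (by
              rw [← LinearMap.comp_apply, ← ResidueExt.map_comp]
              have : (LinearMap.range φ).subtype ∘ₗ φ.rangeRestrict = φ := rfl
              rw [this, hz, map_zero]
              rfl))
            rw [Subsingleton.elim y 0, map_zero]
          · lia
          · refine (hτ.2 ?_).elim
            have i1 := hsd.1 1 (by lia)
            have i2 := hF.1 0 (by lia)
            have i3 := hC.subsingleton
            have : ∀ x, ∃ y, δ 0 y = x := fun x => (h3 0 x).mp (Subsingleton.elim _ _)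
            exact Function.Surjective.subsingleton (f := δ 0) this
      · obtain ⟨φ⟩ := nonempty_torModule_succ_succ_equiv N (Submodule.subtype_injective _) hex hg q
        have := ih hp hT (hτ.of_equiv φ) (by lia)
        lia

end MinimalResolutions

section FiniteProjectiveDimension

open TensorProduct

variable {A : Type u} [CommRing A]

lemma HasFiniteProjDim.exists_hasProjectiveDimensionLT {M : Type u} [AddCommGroup M] [Module A M]
    (h : HasFiniteProjDim A M) : ∃ n, HasProjectiveDimensionLT (ModuleCat.of A M) n := by
  obtain ⟨R, hR⟩ := h
  have proj n : HasProjectiveDimensionLT (R.G n) 1 :=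
    have : Projective (R.G n) := (IsProjective.iff_projective (R.G n)).mp (hR n)
    inferInstance
  have proj' n k : HasProjectiveDimensionLT (R.G n) (k + 1) :=
    have := proj n
    hasProjectiveDimensionLT_of_ge _ 1 (k + 1) (by lia)
  have key (k n : ℕ) (hkn : R.len < n + k) :
      HasProjectiveDimensionLT (ModuleCat.of A (LinearMap.range (R.d n))) k := by
    induction k generalizing n with
    | zero =>
      have := R.bounded n hkn
      exact (ModuleCat.isZero_of_subsingleton _).hasProjectiveDimensionLT_zero
    | succ k ih =>
      let S : ShortComplex (ModuleCat.{u} A) := ShortComplex.mk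
        (ModuleCat.ofHom (LinearMap.range (R.d (n + 1))).subtype)
        (ModuleCat.ofHom (R.d n).rangeRestrict) (by
          ext ⟨_, x, rfl⟩
          exact (R.exact_d n).apply_apply_eq_zero x)
      have hS : S.ShortExact := ModuleCat.shortExact_of_function
        (Submodule.subtype_injective _)
        (fun x => by
          change (R.d n).rangeRestrict x = 0 ↔ _
          rw [← Subtype.val_inj]
          change R.d n x = 0 ↔ x ∈ Set.range (LinearMap.range (R.d (n + 1))).subtype
          rw [R.exact_d n x, Submodule.coe_subtype, Subtype.range_coe]
          rfl)
        (LinearMap.surjective_rangeRestrict _)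
      exact hS.hasProjectiveDimensionLT_X₃ k (ih (n + 1) (by lia)) (proj' (n + 1) k)
  let S : ShortComplex (ModuleCat.{u} A) := ShortComplex.mk
    (ModuleCat.ofHom (LinearMap.range (R.d 0)).subtype) (ModuleCat.ofHom R.aug) (by
      ext ⟨_, x, rfl⟩
      exact R.exact_aug.apply_apply_eq_zero x)
  have hS : S.ShortExact := ModuleCat.shortExact_of_function (Submodule.subtype_injective _)
    (fun x => by
      change R.aug x = 0 ↔ x ∈ Set.range (LinearMap.range (R.d 0)).subtype
      rw [R.exact_aug x, Submodule.coe_subtype, Subtype.range_coe]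
      rfl)
    R.aug_surj
  exact ⟨R.len + 1 + 1, hS.hasProjectiveDimensionLT_X₃ (R.len + 1) (key _ 0 (by lia)) (proj' 0 _)⟩

variable [IsLocalRing A]

/-- Every finitely generated module over a local ring admits a minimal free cover. -/
lemma exists_minimal_free_cover (M : Type u) [AddCommGroup M] [Module A M] [Module.Finite A M] :
    ∃ (F : Type u) (_ : AddCommGroup F) (_ : Module A F) (g : F →ₗ[A] M),
      Module.Free A F ∧ Module.Finite A F ∧ Function.Surjective g ∧
        LinearMap.ker g ≤ maximalIdeal A • (⊤ : Submodule A F) := by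
  let w := Module.Free.chooseBasis (ResidueField A) (ResidueField A ⊗[A] M)
  obtain ⟨v, hv⟩ := (TensorProduct.mk_surjective A M (ResidueField A)
    Ideal.Quotient.mk_surjective).comp_left w
  refine ⟨_ →₀ A, inferInstance, inferInstance, Finsupp.linearCombination A v, inferInstance,
    inferInstance, ?_, fun x hx => ?_⟩
  · rw [← LinearMap.range_eq_top, Finsupp.range_linearCombination]
    exact span_eq_top_of_tmul_eq_basis v w (congrFun hv)
  · have h1 : ∑ i, residue A (x i) • w i = 0 := by
      have h2 : (1 : ResidueField A) ⊗ₜ[A] Finsupp.linearCombination A v x = 0 := by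
        rw [LinearMap.mem_ker.mp hx, TensorProduct.tmul_zero]
      rw [Finsupp.linearCombination_apply, Finsupp.sum_fintype _ _ (by simp),
        TensorProduct.tmul_sum] at h2
      rw [← h2]
      refine Finset.sum_congr rfl fun i _ => ?_
      rw [← congrFun hv i, TensorProduct.tmul_smul, ← ResidueField.algebraMap_eq, algebraMap_smul]
      rfl
    have h3 := Fintype.linearIndependent_iff.mp w.linearIndependent _ h1
    rw [← Finsupp.sum_single x]
    refine Submodule.sum_mem _ fun i _ => ?_
    rw [← mul_one (x i), ← smul_eq_mul, ← Finsupp.smul_single]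
    exact Submodule.smul_mem_smul ((residue_eq_zero_iff _).mp (h3 i)) trivial

lemma exists_hasMinFreeLength_of_hasProjectiveDimensionLT [IsNoetherianRing A] (n : ℕ)
    (M : Type u) [AddCommGroup M] [Module A M] [Module.Finite A M] [Nontrivial M]
    (h : HasProjectiveDimensionLT (ModuleCat.of A M) n) : ∃ p, HasMinFreeLength A p M := by
  induction n generalizing M with
  | zero =>
    have := ModuleCat.subsingleton_of_isZero
      (isZero_of_hasProjectiveDimensionLT_zero (ModuleCat.of A M))
    exact (not_subsingleton M this).elim
  | succ n ih =>
    cases n with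
    | zero =>
      have : Projective (ModuleCat.of A M) := projective_iff_hasProjectiveDimensionLT_one.mpr h
      have : Module.Projective A M := (IsProjective.iff_projective M).mpr this
      exact ⟨0, Module.free_of_flat_of_isLocalRing, inferInstance, inferInstance⟩
    | succ n =>
      obtain ⟨F, _, _, g, _, _, hg, hK⟩ := exists_minimal_free_cover (A := A) M
      have : Nontrivial F := hg.nontrivial
      cases subsingleton_or_nontrivial (LinearMap.ker g) with
      | inl hs =>
        have hinj : Function.Injective g :=
          LinearMap.ker_eq_bot.mp ((Submodule.subsingleton_iff_eq_bot).mp hs)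
        have e := LinearEquiv.ofBijective g ⟨hinj, hg⟩
        exact ⟨0, Module.Free.of_equiv e, inferInstance, inferInstance⟩
      | inr hn =>
        let S : ShortComplex (ModuleCat.{u} A) := ShortComplex.mk
          (ModuleCat.ofHom (LinearMap.ker g).subtype) (ModuleCat.ofHom g) (by
            ext x
            exact x.2)
        have hS : S.ShortExact := ModuleCat.shortExact_of_function
          (Submodule.subtype_injective _) (LinearMap.exact_subtype_ker_map g) hg
        have : Projective (ModuleCat.of A F) :=
          (IsProjective.iff_projective F).mp inferInstance
        obtain ⟨p, hp⟩ := ih (LinearMap.ker g)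
          ((hS.hasProjectiveDimensionLT_X₃_iff n this).mp h)
        exact ⟨p + 1, F, _, _, g, inferInstance, inferInstance, inferInstance, hg, hK, hp⟩

lemma HasFiniteProjDim.exists_hasMinFreeLength [IsNoetherianRing A]
    {M : Type u} [AddCommGroup M] [Module A M] [Module.Finite A M] [Nontrivial M]
    (h : HasFiniteProjDim A M) : ∃ p, HasMinFreeLength A p M :=
  have ⟨n, hn⟩ := h.exists_hasProjectiveDimensionLT
  exists_hasMinFreeLength_of_hasProjectiveDimensionLT n M hn

lemma CxBound.eventually_eq_zero {β : ℕ → ℕ} (h : CxBound β 0) : ∃ L, ∀ n, L < n → β n = 0 := by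
  obtain ⟨a, N, h⟩ := h
  obtain ⟨B, hB⟩ := exists_nat_ge a
  refine ⟨max N B, fun n hn => ?_⟩
  have h1 := h n (by lia)
  rw [Nat.cast_zero, zero_sub, Real.rpow_neg_one] at h1
  have hn0 : (0 : ℝ) < n := by exact_mod_cast (by lia : 0 < n)
  have h2 : (B : ℝ) < n := by exact_mod_cast (by lia : B < n)
  have h3 : (β n : ℝ) < 1 := by
    refine h1.trans_lt ?_
    rw [← div_eq_mul_inv, div_lt_one hn0]
    linarith
  exact Nat.lt_one_iff.mp (by exact_mod_cast h3)

lemma hasFiniteProjDim_of_complexity_eq_zero {M : Type u} [AddCommGroup M] [Module A M]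
    (h : complexity A M = 0) : HasFiniteProjDim A M := by
  have hne : {t : ℕ∞ | ∃ t' : ℕ, t = (t' : ℕ∞) ∧
      ∃ R : MinFreeRes A M, CxBound R.betti t'}.Nonempty := by
    rw [Set.nonempty_iff_ne_empty]
    intro he
    rw [complexity, he, sInf_empty] at h
    exact ENat.top_ne_zero h
  obtain ⟨t, ht, R, hR⟩ := csInf_mem hne
  change complexity A M = t at ht
  obtain rfl : t = 0 := by
    rw [h] at ht
    exact_mod_cast ht.symm
  obtain ⟨L, hL⟩ := hR.eventually_eq_zero
  refine ⟨⟨L, R.F, R.d, R.aug, fun n hn => ?_, R.aug_surj, R.exact_aug, R.exact_d⟩, fun n => ?_⟩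
  · have := R.free n
    have := R.fin n
    exact (Module.finrank_eq_zero_iff_of_free A _).mp (hL n hn)
  · have := R.free n
    exact inferInstanceAs (Module.Projective A (R.F n))

end FiniteProjectiveDimension

section Reduction

variable {A : Type u} [CommRing A]

lemma Function.Exact.range_subtype {X Y Z : Type*} [AddCommGroup X] [AddCommGroup Y]
    [AddCommGroup Z] [Module A X] [Module A Y] [Module A Z] {f : X →ₗ[A] Y} {g : Y →ₗ[A] Z}
    (h : Function.Exact f g) : Function.Exact (LinearMap.range f).subtype g := by
  rw [LinearMap.exact_iff, Submodule.range_subtype, h.linearMap_ker_eq]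

lemma Function.Exact.range_subtype_rangeRestrict {X Y Z : Type*} [AddCommGroup X] [AddCommGroup Y]
    [AddCommGroup Z] [Module A X] [Module A Y] [Module A Z] {f : X →ₗ[A] Y} {g : Y →ₗ[A] Z}
    (h : Function.Exact f g) : Function.Exact (LinearMap.range f).subtype g.rangeRestrict := by
  rw [LinearMap.exact_iff, Submodule.range_subtype, LinearMap.ker_rangeRestrict,
    h.linearMap_ker_eq]

lemma torModule_subsingleton_of_exact {X Y Z : Type u} [AddCommGroup X] [AddCommGroup Y]
    [AddCommGroup Z] [Module A X] [Module A Y] [Module A Z] {f : X →ₗ[A] Y} {g : Y →ₗ[A] Z}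
    (N : Type u) [AddCommGroup N] [Module A N]
    (hf : Function.Injective f) (hfg : Function.Exact f g) (hg : Function.Surjective g) {n : ℕ}
    (hX : Subsingleton (torModule A X N n)) (hZ : Subsingleton (torModule A Z N n)) :
    Subsingleton (torModule A Y N n) := by
  obtain ⟨F, G, -, -, -, h, -⟩ := torModule_long_exact N hf hfg hg
  refine subsingleton_of_forall_eq 0 fun y => ?_
  obtain ⟨x, rfl⟩ := (h n y).mp (Subsingleton.elim _ _)
  rw [Subsingleton.elim x 0, map_zero]

open TensorProduct in
lemma torModule_finite [IsNoetherianRing A] (N : Type u) [AddCommGroup N] [Module A N]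
    [Module.Finite A N] (n : ℕ) (M : Type u) [AddCommGroup M] [Module A M] [Module.Finite A M] :
    Module.Finite A (torModule A M N n) := by
  induction n generalizing M with
  | zero =>
    obtain ⟨e⟩ := nonempty_torModule_zero_equiv (A := A) M N
    exact Module.Finite.equiv e.symm
  | succ n ih =>
    obtain ⟨k, g, hg⟩ := Module.Finite.exists_fin' A M
    let ψ : (ULift.{u} (Fin k) → A) →ₗ[A] M := g ∘ₗ (LinearMap.funLeft A A ULift.up)
    have hψ : Function.Surjective ψ :=
      hg.comp (LinearMap.funLeft_surjective_of_injective A A _ ULift.up_injective)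
    have h := LinearMap.exact_subtype_ker_map ψ
    cases n with
    | zero =>
      obtain ⟨d, hd, -⟩ := exists_torModule_one_exact N (Submodule.subtype_injective _) h hψ
      have := isNoetherian_of_isNoetherianRing_of_finite A (LinearMap.ker ψ ⊗[A] N)
      exact Module.Finite.of_injective d hd
    | succ n =>
      obtain ⟨e⟩ := nonempty_torModule_succ_succ_equiv N (Submodule.subtype_injective _) h hψ n
      have := ih (LinearMap.ker ψ)
      exact Module.Finite.equiv e.symm

variable [IsLocalRing A]

section

variable {X Y Z : Type u} [AddCommGroup X] [AddCommGroup Y] [AddCommGroup Z]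
  [Module A X] [Module A Y] [Module A Z] {f : X →ₗ[A] Y} {g : Y →ₗ[A] Z} {d : ℕ}

lemma ResidueExt.subsingleton_left_of_exact (hf : Function.Injective f)
    (hfg : Function.Exact f g) (hg : Function.Surjective g)
    (hY : ∀ i < d, Subsingleton (ResidueExt A Y i))
    (hZ : ∀ i < d, Subsingleton (ResidueExt A Z i)) :
    ∀ i < d, Subsingleton (ResidueExt A X i) := by
  intro i hi
  have := hY i hi
  cases i with
  | zero => exact (map_zero_injective hf).subsingleton
  | succ i =>
    have := hZ i (by lia)
    obtain ⟨δ, -, h2, h⟩ := long_exact hf hfg hg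
    refine subsingleton_of_forall_eq 0 fun x => ?_
    obtain ⟨z, rfl⟩ := (h i x).mp (Subsingleton.elim _ _)
    rw [Subsingleton.elim z 0]
    exact (h2 i 0).mpr ⟨0, _root_.map_zero _⟩

lemma HasExtDepth.middle_of_exact (hf : Function.Injective f)
    (hfg : Function.Exact f g) (hg : Function.Surjective g) (hX : HasExtDepth A X d)
    (hZ : ∀ i < d, Subsingleton (ResidueExt A Z i)) : HasExtDepth A Y d := by
  obtain ⟨δ, h1, h2, h3⟩ := ResidueExt.long_exact hf hfg hg
  refine ⟨fun i hi => subsingleton_of_forall_eq 0 fun y => ?_, fun hY => hX.2 ?_⟩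
  · have := hX.1 i hi
    have := hZ i hi
    obtain ⟨x, rfl⟩ := (h1 i y).mp (Subsingleton.elim _ _)
    rw [Subsingleton.elim x 0, map_zero]
  · cases d with
    | zero => exact (ResidueExt.map_zero_injective hf).subsingleton
    | succ d =>
      have := hZ d (by lia)
      refine subsingleton_of_forall_eq 0 fun x => ?_
      obtain ⟨z, rfl⟩ := (h3 d x).mp (Subsingleton.elim _ _)
      rw [Subsingleton.elim z 0]
      exact (h2 d 0).mpr ⟨0, map_zero _⟩

end

section Syzygy

variable {M S : Type u} [AddCommGroup M] [Module A M] [AddCommGroup S] [Module A S] {j : ℕ}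

lemma IsSyzygy.finite [Module.Finite A M] (h : IsSyzygy A M S j) : Module.Finite A S := by
  cases j with
  | zero =>
    obtain ⟨e⟩ := h
    exact Module.Finite.equiv e.symm
  | succ j =>
    obtain ⟨R, ⟨e⟩⟩ := h
    have := R.fin (j + 1)
    exact Module.Finite.equiv e.symm

lemma IsSyzygy.subsingleton_torModule (h : IsSyzygy A M S j) (N : Type u) [AddCommGroup N]
    [Module A N] {n : ℕ} (hM : Subsingleton (torModule A M N (n + j + 1))) :
    Subsingleton (torModule A S N (n + 1)) := by
  cases j with
  | zero =>
    obtain ⟨e⟩ := h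
    obtain ⟨φ⟩ := nonempty_torModule_equiv_of_equiv N e (n + 1)
    exact φ.toEquiv.subsingleton
  | succ j =>
    obtain ⟨R, ⟨e⟩⟩ := h
    obtain ⟨φ⟩ := nonempty_torModule_equiv_of_equiv N e (n + 1)
    suffices Subsingleton (torModule A (LinearMap.range (R.d j)) N (n + 1)) from
      φ.toEquiv.subsingleton
    clear φ e
    induction j generalizing n with
    | zero =>
      have := R.free 0
      obtain ⟨φ⟩ := nonempty_torModule_succ_succ_equiv N (Submodule.subtype_injective _)
        R.exact_aug.range_subtype R.aug_surj n
      exact φ.symm.toEquiv.subsingleton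
    | succ j ih =>
      have := R.free (j + 1)
      obtain ⟨φ⟩ := nonempty_torModule_succ_succ_equiv N (Submodule.subtype_injective _)
        (R.exact_d j).range_subtype_rangeRestrict (LinearMap.surjective_rangeRestrict _) n
      have := ih (n := n + 1) (by rwa [show n + 1 + (j + 1) + 1 = n + (j + 1 + 1) + 1 by lia])
      exact φ.symm.toEquiv.subsingleton

lemma IsSyzygy.subsingleton_residueExt (h : IsSyzygy A M S j) {d : ℕ}
    (hA : ∀ i < d, Subsingleton (ResidueExt A A i))
    (hM : ∀ i < d, Subsingleton (ResidueExt A M i)) :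
    ∀ i < d, Subsingleton (ResidueExt A S i) := by
  cases j with
  | zero =>
    obtain ⟨e⟩ := h
    exact fun i hi => ResidueExt.subsingleton_of_equiv e (hM i hi)
  | succ j =>
    obtain ⟨R, ⟨e⟩⟩ := h
    suffices ∀ i < d, Subsingleton (ResidueExt A (LinearMap.range (R.d j)) i) from
      fun i hi => ResidueExt.subsingleton_of_equiv e (this i hi)
    clear e
    have hF n : ∀ i < d, Subsingleton (ResidueExt A (R.F n) i) := fun i hi =>
      have := R.free n
      have := R.fin n
      ResidueExt.subsingleton_of_equiv (TensorProduct.rid A (R.F n)).symm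
        (ResidueExt.subsingleton_free_tensor (R.F n) A (hA i hi))
    induction j with
    | zero =>
      exact ResidueExt.subsingleton_left_of_exact (Submodule.subtype_injective _)
        R.exact_aug.range_subtype R.aug_surj (hF 0) hM
    | succ j ih =>
      exact ResidueExt.subsingleton_left_of_exact (Submodule.subtype_injective _)
        (R.exact_d j).range_subtype_rangeRestrict (LinearMap.surjective_rangeRestrict _)
        (hF (j + 1)) ih

end Syzygy

section Step

variable {M K : ModuleCat.{u} A} {t : ℕ}

lemma ReducesWithDeg.finite (h : ReducesWithDeg A M K t) [Module.Finite A M] :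
    Module.Finite A K := by
  obtain ⟨-, S, _, _, hS, f, g, -, hg, hfg⟩ := h
  have := hS.finite
  exact Module.Finite.of_exact hfg hg

lemma ReducesWithDeg.nontrivial (h : ReducesWithDeg A M K t) [Nontrivial M] : Nontrivial K := by
  obtain ⟨-, S, _, _, -, f, g, hf, -, -⟩ := h
  exact hf.nontrivial

lemma ReducesWithDeg.hasExtDepth (h : ReducesWithDeg A M K t) {d : ℕ} (hM : HasExtDepth A M d)
    (hA : ∀ i < d, Subsingleton (ResidueExt A A i)) : HasExtDepth A K d := by
  obtain ⟨-, S, _, _, hS, f, g, hf, hg, hfg⟩ := h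
  exact hM.middle_of_exact hf hfg hg (hS.subsingleton_residueExt hA hM.1)

variable {N : Type u} [AddCommGroup N] [Module A N] {q : ℕ}

lemma ReducesWithDeg.subsingleton_torModule (h : ReducesWithDeg A M K t)
    (hv : ∀ n, q < n → Subsingleton (torModule A M N n)) :
    ∀ n, q < n → Subsingleton (torModule A K N n) := by
  obtain ⟨-, S, _, _, hS, f, g, hf, hg, hfg⟩ := h
  intro n hn
  obtain ⟨n, rfl⟩ : ∃ m, n = m + 1 := ⟨n - 1, by lia⟩
  exact torModule_subsingleton_of_exact N hf hfg hg (hv _ hn)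
    (hS.subsingleton_torModule N (hv _ (by lia)))

lemma ReducesWithDeg.hasExtDepth_torModule (h : ReducesWithDeg A M K t)
    (hv : ∀ n, q < n → Subsingleton (torModule A M N n)) {τ : ℕ}
    (hτ : HasExtDepth A (torModule A M N q) τ) (hc : τ = 0 ∨ 1 ≤ q ∧ 2 ≤ t) :
    HasExtDepth A (torModule A K N q) τ := by
  obtain ⟨ht, S, _, _, hS, f, g, hf, hg, hfg⟩ := h
  obtain ⟨F, G, δ, -, -, h1, -, h3, -⟩ := torModule_long_exact N hf hfg hg
  have := hS.subsingleton_torModule (n := q) N (hv _ (by lia))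
  have hF : Function.Injective (F q) := by
    rw [injective_iff_map_eq_zero]
    intro x hx
    obtain ⟨z, rfl⟩ := (h3 q x).mp hx
    rw [Subsingleton.elim z 0, map_zero]
  rcases hc with rfl | ⟨hq, ht⟩
  · exact ⟨fun i hi => absurd hi (Nat.not_lt_zero i),
      fun _ => hτ.2 (ResidueExt.map_zero_injective hF).subsingleton⟩
  · obtain ⟨q, rfl⟩ : ∃ m, q = m + 1 := ⟨q - 1, by lia⟩
    have := hS.subsingleton_torModule (n := q) N (hv _ (by lia))
    exact hτ.of_equiv (LinearEquiv.ofBijective (F (q + 1))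
      ⟨hF, fun y => (h1 (q + 1) y).mp (Subsingleton.elim _ _)⟩)

end Step

/-- The depth formula for modules of finite projective dimension. -/
lemma HasFiniteProjDim.depth_formula [IsNoetherianRing A] {M N : Type u} [AddCommGroup M]
    [Module A M] [Module.Finite A M] [Nontrivial M] [AddCommGroup N] [Module A N]
    (h : HasFiniteProjDim A M) {a d e q τ : ℕ} (ha : HasExtDepth A A a) (hd : HasExtDepth A M d)
    (he : HasExtDepth A N e) (hv : ∀ n, q < n → Subsingleton (torModule A M N n))
    (hτ : HasExtDepth A (torModule A M N q) τ) (hc : τ = 0 ∨ 1 ≤ q ∧ τ = 1) :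
    d + e + q = a + τ := by
  obtain ⟨p, hp⟩ := h.exists_hasMinFreeLength
  have hT : TorIndep A M A := fun n hn => by
    obtain ⟨n, rfl⟩ : ∃ m, n = m + 1 := ⟨n - 1, by lia⟩
    have : Projective (ModuleCat.of A A) := (IsProjective.iff_projective A).mp inferInstance
    exact ModuleCat.subsingleton_of_isZero
      (isZero_Tor_succ_of_projective _ (ModuleCat.of A M) (ModuleCat.of A A) n)
  obtain ⟨s, hs, hMs⟩ := hp.hasExtDepth_tensor ha hT
  have h1 := hd.unique (hMs.of_equiv (TensorProduct.rid A M))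
  have h2 := hp.depth_formula he hv hτ hc
  lia

lemma HasRedCxCat.depth_formula [IsNoetherianRing A] {M : ModuleCat.{u} A} {N : Type u}
    [hfin : Module.Finite A M] [hnt : Nontrivial M] [AddCommGroup N] [Module A N]
    (h : HasRedCxCat A M) {a d e q : ℕ} (ha : HasExtDepth A A a) (hd : HasExtDepth A M d)
    (hda : d ≤ a) (he : HasExtDepth A N e)
    (hv : ∀ n, q < n → Subsingleton (torModule A M N n))
    (hτ : HasExtDepth A (torModule A M N q) 0) : d + e + q = a := by
  induction h generalizing hfin hnt with
  | of_finite_pd M h => exact h.depth_formula ha hd he hv hτ (.inl rfl)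
  | of_step M K t _ _ h _ _ ih =>
    have := h.finite
    have := h.nontrivial
    exact ih (h.hasExtDepth hd fun i hi => ha.1 i (by lia)) (h.subsingleton_torModule hv)
      (h.hasExtDepth_torModule hv hτ (.inl rfl))

lemma IsReducingSeq.depth_formula [IsNoetherianRing A] {t : ℕ}
    {Ks : Fin (t + 1) → ModuleCat.{u} A} {degs : Fin t → ℕ} (h : IsReducingSeq A t Ks degs)
    (hdeg : ∀ i, 2 ≤ degs i) {N : Type u} [Module.Finite A (Ks 0)] [Nontrivial (Ks 0)]
    [AddCommGroup N] [Module A N] {a d e q τ : ℕ} (ha : HasExtDepth A A a)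
    (hd : HasExtDepth A (Ks 0) d) (hda : d ≤ a) (he : HasExtDepth A N e)
    (hv : ∀ n, q < n → Subsingleton (torModule A (Ks 0) N n))
    (hτ : HasExtDepth A (torModule A (Ks 0) N q) τ) (hq : 1 ≤ q) (hτ1 : τ ≤ 1) :
    d + e + q = a + τ := by
  induction t with
  | zero =>
    have hpd : HasFiniteProjDim A (Ks 0) := hasFiniteProjDim_of_complexity_eq_zero h.2.2
    exact hpd.depth_formula ha hd he hv hτ (by lia)
  | succ t ih =>
    have h0 := h.1 0
    have h0' : ReducesWithDeg A (Ks 0) (Ks (Fin.succ 0)) (degs 0) := h0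
    have := h0'.finite
    have := h0'.nontrivial
    refine ih (Ks := fun i => Ks i.succ) (degs := fun i => degs i.succ)
      ⟨fun i => h.1 i.succ, fun i => h.2.1 i.succ, h.2.2⟩ (fun i => hdeg _)
      (h0'.hasExtDepth hd fun i hi => ha.1 i (by lia)) (h0'.subsingleton_torModule hv)
      (h0'.hasExtDepth_torModule hv hτ (.inr ⟨hq, hdeg 0⟩))

lemma exists_isReducingSeq_of_two_le_upperReducingDegree {M : Type u} [AddCommGroup M] [Module A M]
    (hM : ¬ HasFiniteProjDim A M) (h : 2 ≤ upperReducingDegree A M) :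
    ∃ (t : ℕ) (Ks : Fin (t + 1) → ModuleCat.{u} A) (degs : Fin t → ℕ),
      Ks 0 = ModuleCat.of A M ∧ IsReducingSeq A t Ks degs ∧ ∀ i, 2 ≤ degs i := by
  rw [upperReducingDegree, if_neg hM] at h
  obtain ⟨r, ⟨t, Ks, degs, h0, hred, rfl⟩, hr⟩ := lt_sSup_iff.mp
    ((by decide : (1 : ℕ∞) < 2).trans_le h)
  refine ⟨t, Ks, degs, h0, hred, fun i => ?_⟩
  have : ((1 : ℕ) : ℕ∞) < degs i := hr.trans_le (iInf_le _ i)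
  exact_mod_cast this

end Reduction

/-- **Depth formula via Tor (Theorem 2.3).** Let `A` be a Cohen-Macaulay local ring and
`M`, `N` nonzero finitely generated `A`-modules such that `M` has reducible complexity.
Suppose `Tor_n(M, N) = 0` for `n ≫ 0` and let `q` be the largest integer with
`Tor_q(M, N) ≠ 0`. If either (i) `depth Tor_q(M, N) = 0`, or (ii) `q ≥ 1`,
`depth Tor_q(M, N) ≤ 1` and `reddeg* M ≥ 2`, then
`depth M + depth N = dim A + depth Tor_q(M, N) - q`. -/
theorem depth_formula_with_tor (A : Type u) [CommRing A] [IsNoetherianRing A] [IsLocalRing A]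
    (hCM : IsCMLocalRing A)
    (M N : Type u) [AddCommGroup M] [Module A M] [AddCommGroup N] [Module A N]
    [Module.Finite A M] [Module.Finite A N]
    (hM : Nontrivial M) (hN : Nontrivial N)
    (hred : HasReducibleComplexity A M)
    (q : ℕ)
    (hq : ¬ Subsingleton (torModule A M N q))
    (hvanish : ∀ n : ℕ, q < n → Subsingleton (torModule A M N n))
    (hcase :
      moduleDepth A (torModule A M N q) = 0 ∨
      (1 ≤ q ∧ moduleDepth A (torModule A M N q) ≤ 1 ∧
        2 ≤ upperReducingDegree A M)) :
    (moduleDepth A M : WithBot ℕ∞) + (moduleDepth A N : WithBot ℕ∞) + (q : WithBot ℕ∞) =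
      ringKrullDimE A + (moduleDepth A (torModule A M N q) : WithBot ℕ∞) := by
  have := torModule_finite (A := A) N q M
  have := not_subsingleton_iff_nontrivial.mp hq
  obtain ⟨a, ha, hAa, -⟩ := exists_moduleDepth_eq A A
  obtain ⟨d, hd, hMd, hda⟩ := exists_moduleDepth_eq A M
  obtain ⟨e, he, hNe, -⟩ := exists_moduleDepth_eq A N
  obtain ⟨τ, hτ, hTτ, -⟩ := exists_moduleDepth_eq A (torModule A M N q)
  have hdim : ringKrullDimE A = ((a : ℕ∞) : WithBot ℕ∞) := by rw [← ha]; exact hCM.symm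
  change _ ≤ ringKrullDimE A at hda
  rw [hdim] at hda
  replace hda : d ≤ a := by exact_mod_cast hda
  suffices d + e + q = a + τ by
    rw [hd, he, hτ, hdim]
    exact_mod_cast this
  rw [hτ] at hcase
  rcases hcase with h0 | ⟨hq1, h1, h2⟩
  · obtain rfl : τ = 0 := by exact_mod_cast h0
    have : Module.Finite A (ModuleCat.of A M) := ‹Module.Finite A M›
    have : Nontrivial (ModuleCat.of A M) := hM
    exact HasRedCxCat.depth_formula hred hAa hMd hda hNe hvanish hTτ
  · have hτ1 : τ ≤ 1 := by exact_mod_cast h1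
    by_cases hpd : HasFiniteProjDim A M
    · exact hpd.depth_formula hAa hMd hNe hvanish hTτ (by lia)
    · obtain ⟨t, Ks, degs, h0, hseq, hdeg⟩ :=
        exists_isReducingSeq_of_two_le_upperReducingDegree hpd h2
      have h0' : ∀ {P : ModuleCat.{u} A → Prop}, P (ModuleCat.of A M) → P (Ks 0) :=
        fun h => h0 ▸ h
      have : Module.Finite A (Ks 0) := h0' (P := fun X => Module.Finite A X) ‹_›
      have : Nontrivial (Ks 0) := h0' (P := fun X => Nontrivial X) hM
      exact hseq.depth_formula hdeg hAa (h0' (P := fun X => HasExtDepth A X d) hMd) hda hNe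
        (h0' (P := fun X => ∀ n, q < n → Subsingleton (torModule A X N n)) hvanish)
        (h0' (P := fun X => HasExtDepth A (torModule A X N q) τ) hTτ) hq1 hτ1
end
end

section
/- Let A be a Cohen–Macaulay local ring and let M and N be nonzero finitely generated Tor-independent A-modules. Assume M is maximal Cohen–Macaulay and has reducible complexity, and that N has finite Gorenstein dimension. If depth (M ⊗_A N) > 0, then depth N > 0. -/
open IsLocalRing CategoryTheory

universe u

noncomputable section

/-- Vanishing of `Ext^i(X, Y)` for unbundled modules. -/
def ExtVanishes (A : Type u) [CommRing A] (X Y : Type u) [AddCommGroup X] [Module A X]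
    [AddCommGroup Y] [Module A Y] (i : ℕ) : Prop :=
  Subsingleton (Abelian.Ext (ModuleCat.of A X) (ModuleCat.of A Y) i)

/-- Short exact sequences `0 → X → Y → Z → 0` of unbundled modules. -/
structure IsSES {A X Y Z : Type*} [CommRing A] [AddCommGroup X] [Module A X]
    [AddCommGroup Y] [Module A Y] [AddCommGroup Z] [Module A Z]
    (f : X →ₗ[A] Y) (g : Y →ₗ[A] Z) : Prop where
  inj : Function.Injective f
  surj : Function.Surjective g
  exact : Function.Exact f g

/-- The map induced on `Ext^i(X, -)` by a linear map. -/
def extMap {A : Type u} [CommRing A] (X : Type u) [AddCommGroup X] [Module A X]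
    {Y Z : Type u} [AddCommGroup Y] [Module A Y] [AddCommGroup Z] [Module A Z]
    (f : Y →ₗ[A] Z) (i : ℕ) :
    Abelian.Ext (ModuleCat.of A X) (ModuleCat.of A Y) i →+
      Abelian.Ext (ModuleCat.of A X) (ModuleCat.of A Z) i :=
  (Abelian.Ext.mk₀ (ModuleCat.ofHom f)).postcomp (ModuleCat.of A X) (add_zero i)

/-- The map induced on `Ext^i(-, Z)` by a linear map. -/
def extComap {A : Type u} [CommRing A] {X Y : Type u} [AddCommGroup X] [Module A X]
    [AddCommGroup Y] [Module A Y] (f : X →ₗ[A] Y) (Z : Type u) [AddCommGroup Z] [Module A Z]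
    (i : ℕ) :
    Abelian.Ext (ModuleCat.of A Y) (ModuleCat.of A Z) i →+
      Abelian.Ext (ModuleCat.of A X) (ModuleCat.of A Z) i :=
  (Abelian.Ext.mk₀ (ModuleCat.ofHom f)).precomp (ModuleCat.of A Z) (zero_add i)

section

variable {A : Type u} [CommRing A]
variable {X Y Z W : Type u} [AddCommGroup X] [Module A X] [AddCommGroup Y] [Module A Y]
  [AddCommGroup Z] [Module A Z] [AddCommGroup W] [Module A W]

lemma extMap_apply (f : Y →ₗ[A] Z) (i : ℕ)
    (x : Abelian.Ext (ModuleCat.of A X) (ModuleCat.of A Y) i) :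
    extMap X f i x = x.comp (Abelian.Ext.mk₀ (ModuleCat.ofHom f)) (add_zero i) := rfl

lemma extComap_apply (f : X →ₗ[A] Y) (i : ℕ)
    (x : Abelian.Ext (ModuleCat.of A Y) (ModuleCat.of A Z) i) :
    extComap f Z i x = (Abelian.Ext.mk₀ (ModuleCat.ofHom f)).comp x (zero_add i) := rfl

lemma extMap_comp (f : Y →ₗ[A] Z) (g : Z →ₗ[A] W) (i : ℕ)
    (x : Abelian.Ext (ModuleCat.of A X) (ModuleCat.of A Y) i) :
    extMap X (g ∘ₗ f) i x = extMap X g i (extMap X f i x) := by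
  simp [extMap_apply, ModuleCat.ofHom_comp]

lemma extMap_id (i : ℕ) (x : Abelian.Ext (ModuleCat.of A X) (ModuleCat.of A Y) i) :
    extMap X (LinearMap.id : Y →ₗ[A] Y) i x = x := by
  simp [extMap_apply]

lemma extMap_add (f g : Y →ₗ[A] Z) (i : ℕ)
    (x : Abelian.Ext (ModuleCat.of A X) (ModuleCat.of A Y) i) :
    extMap X (f + g) i x = extMap X f i x + extMap X g i x := by
  simp [extMap_apply, ModuleCat.ofHom_add, Abelian.Ext.mk₀_add, Abelian.Ext.comp_add]

lemma extMap_smul (a : A) (f : Y →ₗ[A] Z) (i : ℕ)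
    (x : Abelian.Ext (ModuleCat.of A X) (ModuleCat.of A Y) i) :
    extMap X (a • f) i x = a • extMap X f i x := by
  have : ModuleCat.ofHom (a • f) = a • ModuleCat.ofHom f := rfl
  simp [extMap_apply, this, Abelian.Ext.mk₀_smul]

lemma extMap_zero (i : ℕ) (x : Abelian.Ext (ModuleCat.of A X) (ModuleCat.of A Y) i) :
    extMap X (0 : Y →ₗ[A] Z) i x = 0 := by
  have : ModuleCat.ofHom (0 : Y →ₗ[A] Z) = 0 := rfl
  simp [extMap_apply, this]

lemma extComap_comp (f : X →ₗ[A] Y) (g : Y →ₗ[A] Z) (i : ℕ)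
    (x : Abelian.Ext (ModuleCat.of A Z) (ModuleCat.of A W) i) :
    extComap (g ∘ₗ f) W i x = extComap f W i (extComap g W i x) := by
  simp [extComap_apply, ModuleCat.ofHom_comp]

lemma extComap_id (i : ℕ) (x : Abelian.Ext (ModuleCat.of A X) (ModuleCat.of A Y) i) :
    extComap (LinearMap.id : X →ₗ[A] X) Y i x = x := by
  simp [extComap_apply]

namespace IsSES

variable {f : X →ₗ[A] Y} {g : Y →ₗ[A] Z}

/-- The categorical short complex attached to a short exact sequence. -/
abbrev shortComplex (h : IsSES f g) : ShortComplex (ModuleCat.{u} A) :=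
  ShortComplex.mk (ModuleCat.ofHom f) (ModuleCat.ofHom g) (by
    rw [← ModuleCat.ofHom_comp, h.exact.linearMap_comp_eq_zero]; rfl)

lemma shortExact (h : IsSES f g) : h.shortComplex.ShortExact where
  exact := by
    rw [ShortComplex.ShortExact.moduleCat_exact_iff_function_exact]
    exact h.exact
  mono_f := (ModuleCat.mono_iff_injective _).2 h.inj
  epi_g := (ModuleCat.epi_iff_surjective _).2 h.surj

lemma exists_extMap_left (h : IsSES f g) {i : ℕ}
    (y : Abelian.Ext (ModuleCat.of A W) (ModuleCat.of A Y) i) (hy : extMap W g i y = 0) :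
    ∃ x, extMap W f i x = y :=
  Abelian.Ext.covariant_sequence_exact₂ (ModuleCat.of A W) h.shortExact y hy

lemma exists_extComap_right (h : IsSES f g) {i : ℕ}
    (y : Abelian.Ext (ModuleCat.of A Y) (ModuleCat.of A W) i) (hy : extComap f W i y = 0) :
    ∃ x, extComap g W i x = y :=
  Abelian.Ext.contravariant_sequence_exact₂ h.shortExact (ModuleCat.of A W) y hy

lemma cov_mid (h : IsSES f g) {i : ℕ} (h1 : ExtVanishes A W X i) (h3 : ExtVanishes A W Z i) :
    ExtVanishes A W Y i := by
  unfold ExtVanishes at *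
  refine subsingleton_of_forall_eq 0 fun y => ?_
  obtain ⟨x, rfl⟩ := h.exists_extMap_left y (Subsingleton.elim _ _)
  rw [Subsingleton.elim x 0, map_zero]

lemma con_mid (h : IsSES f g) {i : ℕ} (h1 : ExtVanishes A X W i) (h3 : ExtVanishes A Z W i) :
    ExtVanishes A Y W i := by
  unfold ExtVanishes at *
  refine subsingleton_of_forall_eq 0 fun y => ?_
  obtain ⟨x, rfl⟩ := h.exists_extComap_right y (Subsingleton.elim _ _)
  rw [Subsingleton.elim x 0, map_zero]

lemma cov_right (h : IsSES f g) {i : ℕ} (h2 : ExtVanishes A W Y i)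
    (h1 : ExtVanishes A W X (i + 1)) : ExtVanishes A W Z i := by
  unfold ExtVanishes at *
  refine subsingleton_of_forall_eq 0 fun z => ?_
  obtain ⟨y, rfl⟩ := Abelian.Ext.covariant_sequence_exact₃ (ModuleCat.of A W) h.shortExact z rfl
    (Subsingleton.elim (α := Abelian.Ext (ModuleCat.of A W) (ModuleCat.of A X) (i + 1)) _ _)
  rw [Subsingleton.elim (α := Abelian.Ext (ModuleCat.of A W) (ModuleCat.of A Y) i) y 0]
  simp

lemma cov_left (h : IsSES f g) {i : ℕ} (h3 : ExtVanishes A W Z i)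
    (h2 : ExtVanishes A W Y (i + 1)) : ExtVanishes A W X (i + 1) := by
  unfold ExtVanishes at *
  refine subsingleton_of_forall_eq 0 fun x => ?_
  obtain ⟨z, rfl⟩ := Abelian.Ext.covariant_sequence_exact₁ (ModuleCat.of A W) h.shortExact x
    (Subsingleton.elim (α := Abelian.Ext (ModuleCat.of A W) (ModuleCat.of A Y) (i + 1)) _ _) rfl
  rw [Subsingleton.elim (α := Abelian.Ext (ModuleCat.of A W) (ModuleCat.of A Z) i) z 0]
  simp

lemma con_left (h : IsSES f g) {i : ℕ} (h2 : ExtVanishes A Y W i)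
    (h3 : ExtVanishes A Z W (i + 1)) : ExtVanishes A X W i := by
  unfold ExtVanishes at *
  refine subsingleton_of_forall_eq 0 fun x => ?_
  obtain ⟨y, rfl⟩ := Abelian.Ext.contravariant_sequence_exact₁ h.shortExact (ModuleCat.of A W) x
    (add_comm 1 i)
    (Subsingleton.elim (α := Abelian.Ext (ModuleCat.of A Z) (ModuleCat.of A W) (i + 1)) _ _)
  rw [Subsingleton.elim (α := Abelian.Ext (ModuleCat.of A Y) (ModuleCat.of A W) i) y 0]
  simp

lemma con_right (h : IsSES f g) {i : ℕ} (h1 : ExtVanishes A X W i)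
    (h2 : ExtVanishes A Y W (i + 1)) : ExtVanishes A Z W (i + 1) := by
  unfold ExtVanishes at *
  refine subsingleton_of_forall_eq 0 fun z => ?_
  obtain ⟨x, rfl⟩ := Abelian.Ext.contravariant_sequence_exact₃ h.shortExact (ModuleCat.of A W) z
    (Subsingleton.elim (α := Abelian.Ext (ModuleCat.of A Y) (ModuleCat.of A W) (i + 1)) _ _)
    (add_comm 1 i)
  rw [Subsingleton.elim (α := Abelian.Ext (ModuleCat.of A X) (ModuleCat.of A W) i) x 0]
  simp

lemma con_right_one (h : IsSES f g) (h1 : ∀ u : X →ₗ[A] W, ∃ v : Y →ₗ[A] W, v ∘ₗ f = u)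
    (h2 : ExtVanishes A Y W 1) : ExtVanishes A Z W 1 := by
  unfold ExtVanishes at *
  refine subsingleton_of_forall_eq 0 fun z => ?_
  obtain ⟨x, rfl⟩ := Abelian.Ext.contravariant_sequence_exact₃ h.shortExact (ModuleCat.of A W) z
    (Subsingleton.elim (α := Abelian.Ext (ModuleCat.of A Y) (ModuleCat.of A W) 1) _ _)
    (add_comm 1 0)
  obtain ⟨u, rfl⟩ := Abelian.Ext.addEquiv₀.symm.surjective x
  obtain ⟨v, hv⟩ := h1 u.hom
  have hu : u = ModuleCat.ofHom f ≫ ModuleCat.ofHom v := by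
    rw [← ModuleCat.ofHom_comp, hv]; rfl
  subst hu
  have : Abelian.Ext.addEquiv₀.symm (ModuleCat.ofHom f ≫ ModuleCat.ofHom v) =
      (Abelian.Ext.mk₀ (ModuleCat.ofHom f)).comp (Abelian.Ext.mk₀ (ModuleCat.ofHom v))
        (add_zero 0) := by
    simp
  rw [this]
  exact h.shortExact.extClass_comp_assoc _

lemma exists_extend (h : IsSES f g) (h3 : ExtVanishes A Z W 1) (u : X →ₗ[A] W) :
    ∃ v : Y →ₗ[A] W, v ∘ₗ f = u := by
  unfold ExtVanishes at h3
  obtain ⟨y, hy⟩ := Abelian.Ext.contravariant_sequence_exact₁ h.shortExact (ModuleCat.of A W)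
    (Abelian.Ext.mk₀ (ModuleCat.ofHom u)) (add_zero 1)
    (Subsingleton.elim (α := Abelian.Ext (ModuleCat.of A Z) (ModuleCat.of A W) 1) _ _)
  obtain ⟨v, rfl⟩ := Abelian.Ext.addEquiv₀.symm.surjective y
  refine ⟨v.hom, ?_⟩
  have := congrArg Abelian.Ext.addEquiv₀ hy
  simp only [Abelian.Ext.addEquiv₀_symm_apply, Abelian.Ext.mk₀_comp_mk₀] at this
  have h4 := congrArg ModuleCat.Hom.hom ((Abelian.Ext.mk₀_bijective _ _).1
    (by simpa using hy) : ModuleCat.ofHom f ≫ v = ModuleCat.ofHom u)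
  simpa using h4

lemma extMap_injective_succ (h : IsSES f g) {i : ℕ} (h3 : ExtVanishes A W Z i) :
    Function.Injective (extMap W f (i + 1)) := by
  unfold ExtVanishes at h3
  rw [injective_iff_map_eq_zero]
  intro x hx
  obtain ⟨z, rfl⟩ := Abelian.Ext.covariant_sequence_exact₁ (ModuleCat.of A W) h.shortExact x hx rfl
  rw [Subsingleton.elim (α := Abelian.Ext (ModuleCat.of A W) (ModuleCat.of A Z) i) z 0]
  simp

lemma vanishes_of_extMap_injective (h : IsSES f g) {i : ℕ} (h2 : ExtVanishes A W Y i)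
    (hf : Function.Injective (extMap W f (i + 1))) : ExtVanishes A W Z i := by
  unfold ExtVanishes at *
  refine subsingleton_of_forall_eq 0 fun z => ?_
  have hz : z.comp h.shortExact.extClass rfl = 0 := by
    apply hf
    rw [map_zero, extMap_apply,
      Abelian.Ext.comp_assoc (h₁₂ := rfl) (h₂₃ := add_zero 1) (h := rfl)]
    exact (congrArg (fun t => z.comp t _) h.shortExact.extClass_comp).trans
      (Abelian.Ext.comp_zero ..)
  obtain ⟨y, rfl⟩ := Abelian.Ext.covariant_sequence_exact₃ (ModuleCat.of A W) h.shortExact z rfl hz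
  rw [Subsingleton.elim (α := Abelian.Ext (ModuleCat.of A W) (ModuleCat.of A Y) i) y 0]
  simp

end IsSES

lemma extMap_zero_injective {f : Y →ₗ[A] Z} (hf : Function.Injective f) :
    Function.Injective (extMap X f 0) := by
  have : Mono (ModuleCat.ofHom f) := (ModuleCat.mono_iff_injective _).2 hf
  exact Abelian.Ext.postcomp_mk₀_injective_of_mono (ModuleCat.of A X) (ModuleCat.ofHom f)

lemma extVanishes_of_projective [Module.Projective A X] (i : ℕ) : ExtVanishes A X Y (i + 1) := by
  have := (IsProjective.iff_projective (R := A) X).1 ‹_›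
  exact Abelian.Ext.subsingleton_of_projective ..

lemma ExtVanishes.congr_left {i : ℕ} (e : X ≃ₗ[A] Y) (h : ExtVanishes A X W i) :
    ExtVanishes A Y W i := by
  unfold ExtVanishes at *
  refine subsingleton_of_forall_eq 0 fun y => ?_
  rw [← extComap_id i y, ← e.comp_symm, extComap_comp, Subsingleton.elim (extComap _ W i y) 0,
    map_zero]

lemma ExtVanishes.congr_right {i : ℕ} (e : X ≃ₗ[A] Y) (h : ExtVanishes A W X i) :
    ExtVanishes A W Y i := by
  unfold ExtVanishes at *
  refine subsingleton_of_forall_eq 0 fun y => ?_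
  rw [← extMap_id i y, ← e.comp_symm, extMap_comp, Subsingleton.elim (extMap W _ i y) 0,
    map_zero]

lemma ExtVanishes.prod_left {i : ℕ} (hX : ExtVanishes A X W i) (hY : ExtVanishes A Y W i) :
    ExtVanishes A (X × Y) W i :=
  IsSES.con_mid (f := LinearMap.inl A X Y) (g := LinearMap.snd A X Y)
    ⟨LinearMap.inl_injective, LinearMap.snd_surjective, Function.Exact.inl_snd⟩ hX hY

end

/-- Vanishing of `Tor_i(M, N)`, expressed as the vanishing of `Ext^i(N, -)` of the character
module of `M`. -/
def TorVanishes (A : Type u) [CommRing A] (M N : Type u) [AddCommGroup M] [Module A M]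
    [AddCommGroup N] [Module A N] (i : ℕ) : Prop :=
  ExtVanishes A N (CharacterModule M) i

lemma CharacterModule.dual_exact {A X Y Z : Type*} [CommRing A] [AddCommGroup X] [Module A X]
    [AddCommGroup Y] [Module A Y] [AddCommGroup Z] [Module A Z] {f : X →ₗ[A] Y} {g : Y →ₗ[A] Z}
    (h : Function.Exact f g) : Function.Exact (dual g) (dual f) := by
  intro c
  constructor
  · intro hc
    have hker : g.rangeRestrict.toAddMonoidHom.ker ≤ AddMonoidHom.ker (c : Y →+ AddCircle (1 : ℚ)) := by
      intro y hy
      have hy' : g y = 0 := congrArg Subtype.val hy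
      obtain ⟨x, rfl⟩ := (h y).1 hy'
      exact DFunLike.congr_fun hc x
    let c' : CharacterModule (LinearMap.range g) :=
      AddMonoidHom.liftOfSurjective g.rangeRestrict.toAddMonoidHom
        g.surjective_rangeRestrict ⟨c, hker⟩
    obtain ⟨c'', hc''⟩ := dual_surjective_of_injective (LinearMap.range g).subtype
      Subtype.val_injective c'
    refine ⟨c'', ?_⟩
    ext y
    have h1 : c' (g.rangeRestrict y) = c y :=
      AddMonoidHom.liftOfRightInverse_comp_apply g.rangeRestrict.toAddMonoidHom _
        (Function.rightInverse_surjInv g.surjective_rangeRestrict) ⟨c, hker⟩ y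
    rw [← h1, ← hc'']
    rfl
  · rintro ⟨c', rfl⟩
    ext x
    exact (congrArg c' (h.apply_apply_eq_zero x)).trans (map_zero c')

section

variable {A : Type u} [CommRing A] {X Y Z : Type u} [AddCommGroup X] [Module A X] [AddCommGroup Y]
  [Module A Y] [AddCommGroup Z] [Module A Z]

lemma extVanishes_of_subsingleton_extModule {i : ℕ} (hi : 0 < i)
    (h : Subsingleton (extModule A X Y i)) : ExtVanishes A X Y i := by
  obtain ⟨n, rfl⟩ := Nat.exists_eq_succ_of_ne_zero hi.ne'
  unfold extModule at h
  let P := projectiveResolution (ModuleCat.of A X)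
  have h0 := (ModuleCat.isZero_of_subsingleton _).of_iso
    (P.isoExt (R := A) (n + 1) (ModuleCat.of A Y)).symm
  rw [← HomologicalComplex.exactAt_iff_isZero_homology,
    HomologicalComplex.exactAt_iff' _ n (n + 1) (n + 2) (by simp) (by simp),
    ShortComplex.moduleCat_exact_iff] at h0
  unfold ExtVanishes
  refine subsingleton_of_forall_eq 0 fun y => ?_
  obtain ⟨f, hf, rfl⟩ := P.extMk_surjective y (n + 2) rfl
  rw [P.extMk_eq_zero_iff f (n + 2) rfl hf n rfl]
  exact h0 f hf

lemma torVanishes_of_subsingleton_torModule {i : ℕ} (hi : 0 < i)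
    (h : Subsingleton (torModule A X Y i)) : TorVanishes A X Y i := by
  obtain ⟨n, rfl⟩ := Nat.exists_eq_succ_of_ne_zero hi.ne'
  unfold torModule at h
  let P := projectiveResolution (ModuleCat.of A Y)
  have h0 := (@ModuleCat.isZero_of_subsingleton _ _ _ h).of_iso (P.isoLeftDerivedObj
    ((MonoidalCategory.tensoringLeft (ModuleCat.{u} A)).obj (ModuleCat.of A X)) (n + 1)).symm
  rw [HomologicalComplex.homologyFunctor_obj, ← HomologicalComplex.exactAt_iff_isZero_homology,
    HomologicalComplex.exactAt_iff' _ (n + 2) (n + 1) n (by simp) (by simp),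
    ShortComplex.ShortExact.moduleCat_exact_iff_function_exact] at h0
  have h1 : Function.Exact ((P.complex.d (n + 2) (n + 1)).hom.lTensor X)
      ((P.complex.d (n + 1) n).hom.lTensor X) := h0
  unfold TorVanishes ExtVanishes
  refine subsingleton_of_forall_eq 0 fun y => ?_
  obtain ⟨f, hf, rfl⟩ := P.extMk_surjective y (n + 2) rfl
  rw [P.extMk_eq_zero_iff f (n + 2) rfl hf n rfl]
  let c : CharacterModule (TensorProduct A X (P.complex.X (n + 1))) :=
    CharacterModule.dual (TensorProduct.comm A _ _).toLinearMap (CharacterModule.homEquiv f.hom)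
  have hc : CharacterModule.dual ((P.complex.d (n + 2) (n + 1)).hom.lTensor X) c = 0 := by
    refine CharacterModule.homEquiv.symm.injective ?_
    ext x p
    have := LinearMap.congr_fun (congrArg ModuleCat.Hom.hom hf) p
    exact DFunLike.congr_fun this x
  obtain ⟨c', hc'⟩ := (CharacterModule.dual_exact h1 c).1 hc
  refine ⟨ModuleCat.ofHom (CharacterModule.homEquiv.symm
    (CharacterModule.dual (TensorProduct.comm A _ _).toLinearMap c')), ?_⟩
  ext p x
  exact DFunLike.congr_fun hc' (x ⊗ₜ p)

end

section

variable {A : Type u} [CommRing A] {X Y Z W M K S N : Type u} [AddCommGroup X] [Module A X]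
  [AddCommGroup Y] [Module A Y] [AddCommGroup Z] [Module A Z] [AddCommGroup W] [Module A W]
  [AddCommGroup M] [Module A M] [AddCommGroup K] [Module A K] [AddCommGroup S] [Module A S]
  [AddCommGroup N] [Module A N]

lemma isSES_range {u : X →ₗ[A] Y} {v : Y →ₗ[A] Z} (h : Function.Exact u v) :
    IsSES (LinearMap.range u).subtype v.rangeRestrict where
  inj := Subtype.val_injective
  surj := v.surjective_rangeRestrict
  exact y := by
    rw [Submodule.coe_subtype, Subtype.range_coe, SetLike.mem_coe, LinearMap.mem_range,
      ← Set.mem_range, ← h y]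
    exact Subtype.ext_iff

lemma isSES_range_of_surjective {u : X →ₗ[A] Y} {v : Y →ₗ[A] Z} (h : Function.Exact u v)
    (hv : Function.Surjective v) : IsSES (LinearMap.range u).subtype v where
  inj := Subtype.val_injective
  surj := hv
  exact y := by
    rw [Submodule.coe_subtype, Subtype.range_coe, SetLike.mem_coe, LinearMap.mem_range,
      ← Set.mem_range, ← h y]

lemma isSES_ker {v : Y →ₗ[A] Z} (hv : Function.Surjective v) :
    IsSES (LinearMap.ker v).subtype v :=
  ⟨Subtype.val_injective, hv, fun y => by simp⟩

lemma IsSES.characterModule_dual {f : X →ₗ[A] Y} {g : Y →ₗ[A] Z} (h : IsSES f g) :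
    IsSES (CharacterModule.dual g) (CharacterModule.dual f) :=
  ⟨CharacterModule.dual_injective_of_surjective g h.surj,
    CharacterModule.dual_surjective_of_injective f h.inj, CharacterModule.dual_exact h.exact⟩

lemma IsSES.lTensor {f : X →ₗ[A] Y} {g : Y →ₗ[A] Z} (h : IsSES f g) (hT : TorVanishes A M Z 1) :
    IsSES (f.lTensor M) (g.lTensor M) where
  inj := by
    rw [LinearMap.lTensor_inj_iff_rTensor_inj, rTensor_injective_iff_lcomp_surjective]
    exact fun u => h.exists_extend hT u
  surj := LinearMap.lTensor_surjective M h.surj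
  exact := lTensor_exact M h.exact h.surj

lemma torVanishes_of_flat_left [Module.Flat A M] (i : ℕ) :
    TorVanishes A M N (i + 1) := by
  induction i generalizing N with
  | zero =>
    refine (isSES_ker (Finsupp.linearCombination_id_surjective A N)).con_right_one ?_
      (extVanishes_of_projective 0)
    exact rTensor_injective_iff_lcomp_surjective.1
      (Module.Flat.rTensor_preserves_injective_linearMap (Submodule.subtype _)
        Subtype.val_injective)
  | succ i ih =>
    exact (isSES_ker (Finsupp.linearCombination_id_surjective A N)).con_right ih
      (extVanishes_of_projective (i + 1))

lemma IsSES.torVanishes_mid {f : M →ₗ[A] K} {g : K →ₗ[A] S} (h : IsSES f g) {i : ℕ}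
    (hM : TorVanishes A M N i) (hS : TorVanishes A S N i) : TorVanishes A K N i :=
  h.characterModule_dual.cov_mid hS hM

lemma IsSES.torVanishes_left {f : M →ₗ[A] K} {g : K →ₗ[A] S} (h : IsSES f g) {i : ℕ}
    (hK : TorVanishes A K N i) (hS : TorVanishes A S N (i + 1)) : TorVanishes A M N i :=
  h.characterModule_dual.cov_right hK hS

lemma IsSES.torVanishes_right {f : M →ₗ[A] K} {g : K →ₗ[A] S} (h : IsSES f g) {i : ℕ}
    (hM : TorVanishes A M N i) (hK : TorVanishes A K N (i + 1)) : TorVanishes A S N (i + 1) :=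
  h.characterModule_dual.cov_left hM hK

end

/-- `X` has a resolution of length `n` by modules satisfying `P`, given as a chain of short exact
sequences. -/
inductive HasResLength (A : Type u) [CommRing A] (P : ModuleCat.{u} A → Prop) :
    ℕ → ModuleCat.{u} A → Prop
  | zero (X : ModuleCat.{u} A) : P X → HasResLength A P 0 X
  | succ (n : ℕ) (X G Y : ModuleCat.{u} A) (f : X →ₗ[A] G) (g : G →ₗ[A] Y) :
      P G → IsSES f g → HasResLength A P n X → HasResLength A P (n + 1) Y

lemma FinRes.hasResLength {A : Type u} [CommRing A] {M : Type u} [AddCommGroup M] [Module A M]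
    (R : FinRes A M) {P : ModuleCat.{u} A → Prop} (h0 : ∀ X : ModuleCat.{u} A, Subsingleton X → P X)
    (h : ∀ n, P (R.G n)) : ∃ n, HasResLength A P n (ModuleCat.of A M) := by
  have key : ∀ m n, m + n = R.len →
      HasResLength A P m (ModuleCat.of A (LinearMap.range (R.d n))) := by
    intro m
    induction m with
    | zero =>
      intro n hn
      have := R.bounded (n + 1) (by omega)
      refine .zero _ (h0 _ ?_)
      refine subsingleton_of_forall_eq 0 ?_
      rintro ⟨_, x, rfl⟩
      exact Subtype.ext ((congrArg (R.d n) (Subsingleton.elim x 0)).trans (map_zero _))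
    | succ m ih =>
      intro n hn
      exact .succ m _ (R.G (n + 1)) _ _ _ (h _) (isSES_range (R.exact_d n)) (ih (n + 1) (by omega))
  exact ⟨_, .succ _ _ (R.G 0) _ _ _ (h _) (isSES_range_of_surjective R.exact_aug R.aug_surj)
    (key R.len 0 (by omega))⟩

lemma HasResLength.torVanishes {A : Type u} [CommRing A] {n : ℕ} {M : ModuleCat.{u} A}
    (h : HasResLength A (fun X => Module.Projective A X) n M) {N : Type u} [AddCommGroup N]
    [Module A N] {i : ℕ} (hi : n < i) : TorVanishes A M N i := by
  induction h generalizing i with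
  | zero X hX =>
    obtain ⟨i, rfl⟩ := Nat.exists_eq_succ_of_ne_zero hi.ne'
    exact torVanishes_of_flat_left i
  | succ n X G Y f g hG hfg _ ih =>
    obtain ⟨i, rfl⟩ := Nat.exists_eq_succ_of_ne_zero (Nat.ne_zero_of_lt hi)
    exact hfg.torVanishes_right (ih (by omega)) (torVanishes_of_flat_left i)

lemma MinFreeRes.torVanishes_range {A : Type u} [CommRing A] [IsLocalRing A] {M N : Type u}
    [AddCommGroup M] [Module A M] [AddCommGroup N] [Module A N] (R : MinFreeRes A M) (n : ℕ) {i : ℕ}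
    (hi : 0 < i) (h : TorVanishes A M N (i + (n + 1))) :
    TorVanishes A (LinearMap.range (R.d n)) N i := by
  have hfree := R.free
  obtain ⟨i, rfl⟩ := Nat.exists_eq_succ_of_ne_zero hi.ne'
  induction n generalizing i with
  | zero =>
    exact (isSES_range_of_surjective R.exact_aug R.aug_surj).torVanishes_left
      (torVanishes_of_flat_left i) h
  | succ n ih =>
    refine (isSES_range (R.exact_d n)).torVanishes_left (torVanishes_of_flat_left i)
      (ih (i + 1) (by omega) ?_)
    convert h using 1
    omega

lemma IsSyzygy.torVanishes {A : Type u} [CommRing A] [IsLocalRing A] {M S N : Type u}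
    [AddCommGroup M] [Module A M] [AddCommGroup S] [Module A S] [AddCommGroup N] [Module A N]
    {n : ℕ} (hS : IsSyzygy A M S n) {i : ℕ} (hi : 0 < i) (h : TorVanishes A M N (i + n)) :
    TorVanishes A S N i := by
  cases n with
  | zero =>
    obtain ⟨e⟩ := hS
    exact ExtVanishes.congr_right (CharacterModule.congr e.symm) h
  | succ n =>
    obtain ⟨R, ⟨e⟩⟩ := hS
    exact ExtVanishes.congr_right (CharacterModule.congr e.symm) (R.torVanishes_range n hi h)

/-- A coresolution `0 → G 0 → P 0 → P 1 → ⋯` by finite free modules which stays exact after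
applying `Hom(-, A)`. -/
structure CoRes (A : Type u) [CommRing A] : Type (u + 1) where
  G : ℕ → ModuleCat.{u} A
  P : ℕ → ModuleCat.{u} A
  free : ∀ j, Module.Free A (P j)
  fin : ∀ j, Module.Finite A (P j)
  ι : ∀ j, G j →ₗ[A] P j
  π : ∀ j, P j →ₗ[A] G (j + 1)
  ses : ∀ j, IsSES (ι j) (π j)
  extend : ∀ j (a : G j →ₗ[A] A), ∃ b : P j →ₗ[A] A, b ∘ₗ ι j = a

attribute [instance] CoRes.free CoRes.fin

lemma CoRes.torVanishes_shift {A : Type u} [CommRing A] (C : CoRes A) {M : Type u} [AddCommGroup M]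
    [Module A M] {i : ℕ} (hi : 0 < i) (l : ℕ) : ∀ j,
    TorVanishes A M (C.G (j + l)) (i + l) → TorVanishes A M (C.G j) i := by
  induction l with
  | zero => exact fun j h => h
  | succ l ih =>
    intro j h
    obtain ⟨i, rfl⟩ := Nat.exists_eq_succ_of_ne_zero hi.ne'
    refine ih j ((C.ses (j + l)).con_left ?_ h)
    have := extVanishes_of_projective (A := A) (X := C.P (j + l)) (Y := CharacterModule M) (i + l)
    convert this using 1
    omega

lemma HasRedCxCat.torVanishes {A : Type u} [CommRing A] [IsLocalRing A] {M : ModuleCat.{u} A}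
    (h : HasRedCxCat A M) (C : CoRes A) (j : ℕ) (hev : ∃ n, ∀ i, n ≤ i → TorVanishes A M (C.G j) i)
    {i : ℕ} (hi : 0 < i) : TorVanishes A M (C.G j) i := by
  induction h generalizing i with
  | of_finite_pd M hM =>
    obtain ⟨R, hR⟩ := hM
    obtain ⟨l, hl⟩ := R.hasResLength (P := fun X => Module.Projective A X)
      (fun X hX => inferInstance) hR
    exact C.torVanishes_shift hi l j (hl.torVanishes (by omega))
  | of_step M K t _ _ hred _ _ ih =>
    obtain ⟨ht, S, _, _, hS, f, g, hf, hg, hfg⟩ := hred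
    obtain ⟨n, hn⟩ := hev
    have hses : IsSES f g := ⟨hf, hg, hfg⟩
    have hK : ∀ i, 0 < i → TorVanishes A K (C.G j) i := by
      intro i hi
      refine ih ⟨n + 1, fun i hi => hses.torVanishes_mid (hn i (by omega))
        (hS.torVanishes (by omega) (hn _ (by omega)))⟩ hi
    have key : ∀ m i, 0 < i → n ≤ i + m → TorVanishes A M (C.G j) i := by
      intro m
      induction m with
      | zero => exact fun i _ hi => hn i hi
      | succ m ihm =>
        exact fun i hi him => hses.torVanishes_left (hK i hi)
          (hS.torVanishes (by omega) (ihm _ (by omega) (by omega)))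
    exact key n i hi (by omega)

/-- If all higher `Tor` with the first term of a coresolution vanish, the same holds for all
terms. -/
lemma HasRedCxCat.torVanishes_coRes {A : Type u} [CommRing A] [IsLocalRing A] {M : ModuleCat.{u} A}
    (h : HasRedCxCat A M) (C : CoRes A) (h0 : ∀ i, 0 < i → TorVanishes A M (C.G 0) i) (j : ℕ) :
    ∀ i, 0 < i → TorVanishes A M (C.G j) i := by
  induction j with
  | zero => exact h0
  | succ j ih =>
    refine fun i hi => h.torVanishes C (j + 1) ⟨2, fun i hi => ?_⟩ hi
    obtain ⟨i, rfl⟩ := Nat.exists_eq_add_of_le' (show 1 ≤ i by omega)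
    exact (C.ses j).con_right (ih i (by omega)) (extVanishes_of_projective i)

/-- Reflexive modules whose dual has no higher extensions by the ring. -/
structure DualAcyclic (A : Type u) [CommRing A] (X : Type u) [AddCommGroup X] [Module A X] :
    Prop where
  reflexive : Module.IsReflexive A X
  ext_dual : ∀ i, 0 < i → ExtVanishes A (Module.Dual A X) A i

/-- Modules of Gorenstein dimension zero, in terms of `ExtVanishes`. -/
structure TotallyReflexive (A : Type u) [CommRing A] (X : Type u) [AddCommGroup X] [Module A X] :
    Prop extends DualAcyclic A X where
  ext : ∀ i, 0 < i → ExtVanishes A X A i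

section

variable {A : Type u} [CommRing A] {X Y Z G N F : Type u} [AddCommGroup X] [Module A X]
  [AddCommGroup Y] [Module A Y] [AddCommGroup Z] [Module A Z] [AddCommGroup G] [Module A G]
  [AddCommGroup N] [Module A N] [AddCommGroup F] [Module A F]

lemma GDimZero.totallyReflexive (h : GDimZero A X) : TotallyReflexive A X where
  reflexive := h.1
  ext_dual i hi := extVanishes_of_subsingleton_extModule hi (h.2 i hi).2
  ext i hi := extVanishes_of_subsingleton_extModule hi (h.2 i hi).1

lemma extVanishes_of_projective_of_pos [Module.Projective A X] {i : ℕ} (hi : 0 < i) :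
    ExtVanishes A X Y i := by
  obtain ⟨i, rfl⟩ := Nat.exists_eq_succ_of_ne_zero hi.ne'
  exact extVanishes_of_projective i

lemma totallyReflexive_of_projective [Module.Projective A X] [Module.Finite A X] :
    TotallyReflexive A X where
  reflexive := inferInstance
  ext_dual _ hi := extVanishes_of_projective_of_pos hi
  ext _ hi := extVanishes_of_projective_of_pos hi

lemma TotallyReflexive.prod (hX : TotallyReflexive A X) (hY : TotallyReflexive A Y) :
    TotallyReflexive A (X × Y) where
  reflexive := by
    have := hX.reflexive
    have := hY.reflexive
    infer_instance
  ext_dual i hi := ((hX.ext_dual i hi).prod_left (hY.ext_dual i hi)).congr_left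
    (Module.dualProdDualEquivDual A X Y)
  ext i hi := (hX.ext i hi).prod_left (hY.ext i hi)

namespace IsSES

variable {f : X →ₗ[A] Y} {g : Y →ₗ[A] Z}

lemma dualMap (h : IsSES f g) (hf : ∀ a : X →ₗ[A] A, ∃ b : Y →ₗ[A] A, b ∘ₗ f = a) :
    IsSES g.dualMap f.dualMap where
  inj := LinearMap.dualMap_injective_of_surjective h.surj
  surj := hf
  exact := LinearMap.exact_lcomp_of_exact_of_surjective A h.exact h.surj

lemma isReflexive_left (h : IsSES f g) (hf : ∀ a : X →ₗ[A] A, ∃ b : Y →ₗ[A] A, b ∘ₗ f = a)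
    (hY : Module.IsReflexive A Y) (hZ : Module.IsReflexive A Z) : Module.IsReflexive A X := by
  refine ⟨fun x x' hxx => h.inj ?_, fun ξ => ?_⟩
  · refine (Module.bijective_dual_eval A Y).1 ?_
    ext b
    exact LinearMap.congr_fun hxx (b ∘ₗ f)
  · obtain ⟨y, hy⟩ := (Module.bijective_dual_eval A Y).2 (ξ ∘ₗ f.dualMap)
    have hgy : g y = 0 := by
      refine (Module.bijective_dual_eval A Z).1 ?_
      ext c
      have h1 : c (g y) = ξ ((c ∘ₗ g) ∘ₗ f) := LinearMap.congr_fun hy (c ∘ₗ g)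
      rw [LinearMap.comp_assoc, h.exact.linearMap_comp_eq_zero] at h1
      simpa using h1
    obtain ⟨x, rfl⟩ := (h.exact y).1 hgy
    refine ⟨x, ?_⟩
    ext a
    obtain ⟨b, rfl⟩ := hf a
    exact LinearMap.congr_fun hy b

lemma isReflexive_right (h : IsSES f g) (hf : ∀ a : X →ₗ[A] A, ∃ b : Y →ₗ[A] A, b ∘ₗ f = a)
    (hX : Module.IsReflexive A X) (hY : Module.IsReflexive A Y)
    (hext : ExtVanishes A (Module.Dual A X) A 1) : Module.IsReflexive A Z := by
  have hd := h.dualMap hf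
  refine ⟨(injective_iff_map_eq_zero _).2 fun z hz => ?_, fun ζ => ?_⟩
  · obtain ⟨y, rfl⟩ := h.surj z
    have hy : g.dualMap.dualMap (Module.Dual.eval A Y y) = 0 := by
      ext c
      exact LinearMap.congr_fun hz c
    obtain ⟨ξ, hξ⟩ := (LinearMap.exact_lcomp_of_exact_of_surjective A hd.exact hd.surj _).1 hy
    obtain ⟨x, rfl⟩ := (Module.bijective_dual_eval A X).2 ξ
    have : f x = y := (Module.bijective_dual_eval A Y).1 hξ
    rw [← this, h.exact.apply_apply_eq_zero]
  · obtain ⟨η, rfl⟩ := hd.exists_extend hext ζ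
    obtain ⟨y, rfl⟩ := (Module.bijective_dual_eval A Y).2 η
    exact ⟨g y, rfl⟩

lemma dualAcyclic_right (h : IsSES f g) (hf : ∀ a : X →ₗ[A] A, ∃ b : Y →ₗ[A] A, b ∘ₗ f = a)
    (hX : DualAcyclic A X) (hY : DualAcyclic A Y) : DualAcyclic A Z where
  reflexive := h.isReflexive_right hf hX.reflexive hY.reflexive (hX.ext_dual 1 one_pos)
  ext_dual i hi := (h.dualMap hf).con_left (hY.ext_dual i hi) (hX.ext_dual (i + 1) (by omega))

lemma totallyReflexive_left (h : IsSES f g) (hY : TotallyReflexive A Y)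
    (hZ : TotallyReflexive A Z) : TotallyReflexive A X := by
  have hf : ∀ a : X →ₗ[A] A, ∃ b : Y →ₗ[A] A, b ∘ₗ f = a := h.exists_extend (hZ.ext 1 one_pos)
  refine ⟨⟨h.isReflexive_left hf hY.reflexive hZ.reflexive, fun i hi => ?_⟩,
    fun i hi => h.con_left (hY.ext i hi) (hZ.ext (i + 1) (by omega))⟩
  match i, hi with
  | 1, _ =>
    refine (h.dualMap hf).con_right_one (fun u => ?_) (hY.ext_dual 1 one_pos)
    obtain ⟨z, rfl⟩ := hZ.reflexive.bijective_dual_eval'.2 u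
    obtain ⟨y, rfl⟩ := h.surj z
    exact ⟨Module.Dual.eval A Y y, rfl⟩
  | i + 2, _ =>
    exact (h.dualMap hf).con_right (hZ.ext_dual (i + 1) (by omega)) (hY.ext_dual _ (by omega))

end IsSES

/-- A finite resolution by modules of Gorenstein dimension zero. -/
abbrev HasGLength (A : Type u) [CommRing A] (n : ℕ) (X : ModuleCat.{u} A) : Prop :=
  HasResLength A (fun X => TotallyReflexive A X) n X

lemma HasGLength.left {n : ℕ} {Y : ModuleCat.{u} A} (hY : HasGLength A n Y) {f : X →ₗ[A] Y}
    {g : Y →ₗ[A] Z} (h : IsSES f g) (hZ : TotallyReflexive A Z) :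
    HasGLength A n (ModuleCat.of A X) := by
  cases hY with
  | zero _ hY => exact .zero _ (h.totallyReflexive_left hY hZ)
  | succ n X' G _ f' g' hG h' hX' =>
    let p : LinearMap.ker (g ∘ₗ g') →ₗ[A] X :=
      (LinearEquiv.ofInjective f h.inj).symm.toLinearMap ∘ₗ
        (g' ∘ₗ (LinearMap.ker (g ∘ₗ g')).subtype).codRestrict (LinearMap.range f)
          (fun y => (h.exact _).1 y.2)
    have hp (y) : f (p y) = g' y :=
      congrArg Subtype.val ((LinearEquiv.ofInjective f h.inj).apply_symm_apply _)
    let j : X' →ₗ[A] LinearMap.ker (g ∘ₗ g') := f'.codRestrict _ (fun x => by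
      simp [h'.exact.apply_apply_eq_zero])
    refine .succ n X' (ModuleCat.of A (LinearMap.ker (g ∘ₗ g'))) _ j p
      ((isSES_ker (show Function.Surjective (g ∘ₗ g') from h.surj.comp h'.surj)).totallyReflexive_left hG hZ) ⟨?_, ?_, ?_⟩ hX'
    · exact fun a b hab => h'.inj (congrArg Subtype.val hab)
    · intro x
      obtain ⟨y, hy⟩ := h'.surj (f x)
      refine ⟨⟨y, by simp [hy, h.exact.apply_apply_eq_zero]⟩, h.inj ?_⟩
      rw [hp, hy]
    · intro y
      rw [← map_eq_zero_iff f h.inj, hp, h'.exact]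
      exact ⟨fun ⟨x, hx⟩ => ⟨x, Subtype.ext hx⟩, fun ⟨x, hx⟩ => ⟨x, congrArg Subtype.val hx⟩⟩

lemma HasGLength.prod {n : ℕ} {X : ModuleCat.{u} A} (hX : HasGLength A n X)
    (hF : TotallyReflexive A F) : HasGLength A n (ModuleCat.of A (X × F)) := by
  cases hX with
  | zero _ hX => exact .zero _ (hX.prod hF)
  | succ n X' G _ f g hG h hX =>
    refine .succ n X' (ModuleCat.of A (G × F)) _ (LinearMap.inl A G F ∘ₗ f)
      (g.prodMap LinearMap.id) (hG.prod hF)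
      ⟨LinearMap.inl_injective.comp h.inj, h.surj.prodMap Function.surjective_id, ?_⟩ hX
    rintro ⟨y, z⟩
    simp only [LinearMap.prodMap_apply, LinearMap.id_apply, Prod.mk_eq_zero, h.exact y,
      Set.mem_range, LinearMap.comp_apply, LinearMap.inl_apply, Prod.mk.injEq, exists_and_right]
    exact and_congr_right fun _ => eq_comm

lemma HasGLength.syzygy {n : ℕ} {N : ModuleCat.{u} A} (hN : HasGLength A (n + 1) N)
    [Module.Projective A F] [Module.Finite A F] {f : X →ₗ[A] F} {g : F →ₗ[A] N} (h : IsSES f g) :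
    HasGLength A n (ModuleCat.of A X) := by
  cases hN with
  | succ _ X' G _ f' g' hG h' hX' =>
    obtain ⟨q, hq⟩ := Module.projective_lifting_property g' g h'.surj
    have hq' (y) : g' (q y) = g y := LinearMap.congr_fun hq y
    let p : X →ₗ[A] X' := (LinearEquiv.ofInjective f' h'.inj).symm.toLinearMap ∘ₗ
      (-(q ∘ₗ f)).codRestrict (LinearMap.range f') (fun x => (h'.exact _).1 (by
        simp [hq', h.exact.apply_apply_eq_zero]))
    have hp (x) : f' (p x) = -(q (f x)) :=
      congrArg Subtype.val ((LinearEquiv.ofInjective f' h'.inj).apply_symm_apply _)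
    refine HasGLength.left (HasGLength.prod hX' (totallyReflexive_of_projective (X := F)))
      (f := p.prod f) (g := f'.coprod q) ⟨fun a b hab => h.inj (congrArg Prod.snd hab), fun y => ?_, ?_⟩ hG
    · obtain ⟨z, hz⟩ := h.surj (g' y)
      obtain ⟨x, hx⟩ := (h'.exact (y - q z)).1 (by simp [hq', hz])
      exact ⟨(x, z), by simp [hx]⟩
    · rintro ⟨x, y⟩
      constructor
      · intro hxy
        have hxy : f' x + q y = 0 := hxy
        have hgy : g y = 0 := by
          simpa [h'.exact.apply_apply_eq_zero, hq'] using congrArg g' hxy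
        obtain ⟨z, rfl⟩ := (h.exact y).1 hgy
        exact ⟨z, Prod.ext (h'.inj (by
          rw [show (p.prod f z).1 = p z from rfl, hp, eq_neg_of_add_eq_zero_left hxy])) rfl⟩
      · rintro ⟨z, hz⟩
        obtain ⟨rfl, rfl⟩ := Prod.ext_iff.1 hz
        exact (congrArg (· + q (f z)) (hp z)).trans (neg_add_cancel _)

end

/-- A sequence of syzygies taken with respect to finite free modules. -/
structure FreeSyz (A : Type u) [CommRing A] : Type (u + 1) where
  Z : ℕ → ModuleCat.{u} A
  F : ℕ → ModuleCat.{u} A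
  free : ∀ j, Module.Free A (F j)
  fin : ∀ j, Module.Finite A (F j)
  fin_syz : ∀ j, Module.Finite A (Z j)
  ι : ∀ j, Z (j + 1) →ₗ[A] F j
  π : ∀ j, F j →ₗ[A] Z j
  ses : ∀ j, IsSES (ι j) (π j)

attribute [instance] FreeSyz.free FreeSyz.fin FreeSyz.fin_syz

lemma exists_freeSyz {A : Type u} [CommRing A] [IsNoetherianRing A] (N : ModuleCat.{u} A)
    [hN : Module.Finite A N] : ∃ R : FreeSyz A, R.Z 0 = N := by
  choose rk cov hcov using fun X : {X : ModuleCat.{u} A // Module.Finite A X} =>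
    have := X.2
    Module.Finite.exists_fin' A X.1
  let next (X : {X : ModuleCat.{u} A // Module.Finite A X}) :
      {X : ModuleCat.{u} A // Module.Finite A X} :=
    ⟨ModuleCat.of A (LinearMap.ker (cov X)),
      inferInstanceAs (Module.Finite A (LinearMap.ker (cov X)))⟩
  let s (j : ℕ) := next^[j] ⟨N, hN⟩
  have hs (j : ℕ) : s (j + 1) = next (s j) := Function.iterate_succ_apply' ..
  have key (j : ℕ) : ∃ (ι : (s (j + 1)).1 →ₗ[A] (Fin (rk (s j)) → A))
      (π : (Fin (rk (s j)) → A) →ₗ[A] (s j).1), IsSES ι π := by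
    rw [hs]
    exact ⟨_, _, isSES_ker (hcov (s j))⟩
  choose ι π h using key
  exact ⟨⟨fun j => (s j).1, fun j => ModuleCat.of A (Fin (rk (s j)) → A),
    fun j => inferInstanceAs (Module.Free A (Fin (rk (s j)) → A)),
    fun j => inferInstanceAs (Module.Finite A (Fin (rk (s j)) → A)), fun j => (s j).2, ι, π, h⟩, rfl⟩

namespace FreeSyz

variable {A : Type u} [CommRing A] (R : FreeSyz A)

lemma totallyReflexive {n : ℕ} (h : HasGLength A n (R.Z 0)) {m : ℕ} (hm : n ≤ m) :
    TotallyReflexive A (R.Z m) := by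
  have key : ∀ l j, HasGLength A l (R.Z j) → TotallyReflexive A (R.Z (j + l)) := by
    intro l
    induction l with
    | zero =>
      intro j hj
      cases hj with
      | zero _ h => exact h
    | succ l ih =>
        intro j hj
        have := ih (j + 1) (hj.syzygy (R.ses j))
        rwa [show j + 1 + l = j + (l + 1) by omega] at this
  induction m, hm using Nat.le_induction with
  | base => exact (zero_add n) ▸ key n 0 h
  | succ m _ ih =>
    exact (R.ses m).totallyReflexive_left totallyReflexive_of_projective ih

lemma torVanishes {M : Type u} [AddCommGroup M] [Module A M]
    (h : ∀ i, 0 < i → TorVanishes A M (R.Z 0) i) (j : ℕ) :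
    ∀ i, 0 < i → TorVanishes A M (R.Z j) i := by
  induction j with
  | zero => exact h
  | succ j ih =>
    exact fun i hi => (R.ses j).con_left (extVanishes_of_projective_of_pos hi) (ih (i + 1) (by omega))

end FreeSyz

/-- A finitely generated module whose dual is acyclic starts a coresolution. -/
lemma DualAcyclic.exists_coRes {A : Type u} [CommRing A] [IsNoetherianRing A] {X : Type u}
    [AddCommGroup X] [Module A X] [Module.Finite A X] (h : DualAcyclic A X) :
    ∃ C : CoRes A, Nonempty (X ≃ₗ[A] C.G 0) := by
  have hrefl := h.reflexive
  have : Module.Finite A (ModuleCat.of A (Module.Dual A X)) :=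
    inferInstanceAs (Module.Finite A (Module.Dual A X))
  obtain ⟨R, hR⟩ := exists_freeSyz (ModuleCat.of A (Module.Dual A X))
  have hext : ∀ j i, 0 < i → ExtVanishes A (R.Z j) A i := by
    intro j
    induction j with
    | zero =>
      rw [hR]
      exact h.ext_dual
    | succ j ih =>
      exact fun i hi =>
        (R.ses j).con_left (extVanishes_of_projective_of_pos hi) (ih (i + 1) (by omega))
  have hr : ∀ j, Module.IsReflexive A (R.Z j) := by
    intro j
    induction j with
    | zero =>
      rw [hR]
      exact inferInstanceAs (Module.IsReflexive A (Module.Dual A X))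
    | succ j ih =>
      exact (R.ses j).isReflexive_left ((R.ses j).exists_extend (hext j 1 one_pos))
        inferInstance ih
  refine ⟨⟨fun j => ModuleCat.of A (Module.Dual A (R.Z j)),
    fun j => ModuleCat.of A (Module.Dual A (R.F j)),
    fun j => inferInstanceAs (Module.Free A (Module.Dual A (R.F j))),
    fun j => inferInstanceAs (Module.Finite A (Module.Dual A (R.F j))),
    fun j => (R.π j).dualMap, fun j => (R.ι j).dualMap,
    fun j => (R.ses j).dualMap ((R.ses j).exists_extend (hext j 1 one_pos)), fun j a => ?_⟩, ?_⟩
  · obtain ⟨z, rfl⟩ := (hr j).bijective_dual_eval'.2 a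
    obtain ⟨y, rfl⟩ := (R.ses j).surj z
    exact ⟨Module.Dual.eval A _ y, rfl⟩
  · change Nonempty (X ≃ₗ[A] Module.Dual A (R.Z 0))
    rw [hR]
    exact ⟨Module.evalEquiv A X⟩

section

open TensorProduct

variable {A : Type u} [CommRing A] {X Y Z M F P : Type u} [AddCommGroup X] [Module A X]
  [AddCommGroup Y] [Module A Y] [AddCommGroup Z] [Module A Z] [AddCommGroup M] [Module A M]
  [AddCommGroup F] [Module A F] [AddCommGroup P] [Module A P]

lemma extMap_sum {ι : Type*} (s : Finset ι) (f : ι → Y →ₗ[A] Z) (i : ℕ)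
    (x : Abelian.Ext (ModuleCat.of A X) (ModuleCat.of A Y) i) :
    extMap X (∑ t ∈ s, f t) i x = ∑ t ∈ s, extMap X (f t) i x := by
  classical
  induction s using Finset.induction_on with
  | empty => simp [extMap_zero]
  | insert a s ha ih => rw [Finset.sum_insert ha, Finset.sum_insert ha, extMap_add, ih]

/-- The map `m ↦ m ⊗ y`. -/
def tmulRight (M : Type u) [AddCommGroup M] [Module A M] (y : Y) : M →ₗ[A] M ⊗[A] Y :=
  (TensorProduct.mk A M Y).flip y

lemma lTensor_comp_tmulRight (f : Y →ₗ[A] Z) (y : Y) :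
    f.lTensor M ∘ₗ tmulRight M y = tmulRight M (f y) := by
  ext m
  simp [tmulRight]

/-- The contraction `M ⊗ Y → M` with a functional on `Y`. -/
def tensorContract (M : Type u) [AddCommGroup M] [Module A M] (c : Y →ₗ[A] A) : M ⊗[A] Y →ₗ[A] M :=
  (TensorProduct.rid A M).toLinearMap ∘ₗ c.lTensor M

lemma tensorContract_comp_tmulRight (c : Y →ₗ[A] A) (y : Y) :
    tensorContract M c ∘ₗ tmulRight M y = c y • LinearMap.id := by
  ext m
  simp [tmulRight, tensorContract]

lemma ExtVanishes.tensor_free [Module.Free A F] [Module.Finite A F] {i : ℕ}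
    (h : ExtVanishes A X M i) : ExtVanishes A X (M ⊗[A] F) i := by
  let b := Module.Free.chooseBasis A F
  have hid : (LinearMap.id : M ⊗[A] F →ₗ[A] M ⊗[A] F) =
      ∑ t, tmulRight M (b t) ∘ₗ tensorContract M (b.coord t) := by
    ext m y
    conv_lhs => simp only [AlgebraTensorModule.curry_apply, LinearMap.restrictScalars_self,
      curry_apply, LinearMap.id_coe, id_eq]; rw [← b.sum_repr y, tmul_sum]
    simp [tmulRight, tensorContract]
  unfold ExtVanishes at h ⊢
  refine subsingleton_of_forall_eq 0 fun x => ?_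
  rw [← extMap_id i x, hid, extMap_sum]
  refine Finset.sum_eq_zero fun t _ => ?_
  rw [extMap_comp, Subsingleton.elim (extMap X (tensorContract M (b.coord t)) i x) 0, map_zero]

/-- Maps into finite free modules factor through `f` as soon as functionals do. -/
lemma exists_comp_eq_of_forall_functional [Module.Free A P] [Module.Finite A P] {f : X →ₗ[A] Y}
    (h : ∀ a : X →ₗ[A] A, ∃ b : Y →ₗ[A] A, b ∘ₗ f = a) (φ : X →ₗ[A] P) :
    ∃ ψ : Y →ₗ[A] P, ψ ∘ₗ f = φ := by
  let b := Module.Free.chooseBasis A P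
  choose c hc using fun t => h (b.coord t ∘ₗ φ)
  refine ⟨∑ t, (c t).smulRight (b t), ?_⟩
  ext x
  rw [← b.sum_repr (φ x)]
  simp only [LinearMap.comp_apply, LinearMap.sum_apply, LinearMap.smulRight_apply]
  exact Finset.sum_congr rfl fun t _ => congrArg (· • b t) (LinearMap.congr_fun (hc t) x)

lemma extMap_lTensor_injective_of_factor {f : X →ₗ[A] Y} {φ : X →ₗ[A] P} {ψ : Y →ₗ[A] P}
    (h : ψ ∘ₗ f = φ) {i : ℕ} (hφ : Function.Injective (extMap Z (φ.lTensor M) i)) :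
    Function.Injective (extMap Z (f.lTensor M) i) := by
  intro x y hxy
  apply hφ
  rw [← h, LinearMap.lTensor_comp, extMap_comp, extMap_comp, hxy]

lemma IsSES.extMap_lTensor_injective {f : X →ₗ[A] Y} {g : Y →ₗ[A] Z} (h : IsSES f g)
    (hT : TorVanishes A M Z 1) {i : ℕ} (hV : ∀ j, j < i → ExtVanishes A F (M ⊗[A] Z) j) :
    Function.Injective (extMap F (f.lTensor M) i) := by
  cases i with
  | zero => exact extMap_zero_injective (h.lTensor hT).inj
  | succ i => exact (h.lTensor hT).extMap_injective_succ (hV i i.lt_succ_self)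

lemma CoRes.extVanishes (C : CoRes A) {d : ℕ} (hV : ∀ i, i < d → ExtVanishes A X M i)
    (hT : ∀ j, TorVanishes A M (C.G j) 1) (i : ℕ) :
    ∀ j, i < d → ExtVanishes A X (M ⊗[A] C.G j) i := by
  induction i with
  | zero =>
    intro j hi
    have : Subsingleton (Abelian.Ext (ModuleCat.of A X) (ModuleCat.of A (M ⊗[A] C.P j)) 0) :=
      (hV 0 hi).tensor_free
    exact (extMap_zero_injective (X := X) ((C.ses j).lTensor (hT (j + 1))).inj).subsingleton
  | succ i ih =>
    exact fun j hi => ((C.ses j).lTensor (hT _)).cov_left (ih (j + 1) (by omega))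
      (hV _ hi).tensor_free

end

section

open TensorProduct

variable {A : Type u} [CommRing A] [IsLocalRing A] {M F : Type u} [AddCommGroup M] [Module A M]
  [AddCommGroup F] [Module A F]

lemma smul_ext_residueField {a : A} (ha : a ∈ maximalIdeal A) {i : ℕ} {Y : ModuleCat.{u} A}
    (x : Abelian.Ext (ModuleCat.of A (ResidueField A)) Y i) : a • x = 0 := by
  have h : a • 𝟙 (ModuleCat.of A (ResidueField A)) = 0 := by
    ext y
    change residue A a * y = 0
    rw [(residue_eq_zero_iff a).2 ha, zero_mul]
  rw [← Abelian.Ext.mk₀_id_comp x, ← Abelian.Ext.smul_comp, ← Abelian.Ext.mk₀_smul, h,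
    Abelian.Ext.mk₀_zero, Abelian.Ext.zero_comp]

lemma extMap_tmulRight_eq_zero {y : F} (hy : y ∈ maximalIdeal A • (⊤ : Submodule A F)) {i : ℕ}
    (x : Abelian.Ext (ModuleCat.of A (ResidueField A)) (ModuleCat.of A M) i) :
    extMap (ResidueField A) (tmulRight M y) i x = 0 := by
  induction hy using Submodule.smul_induction_on' with
  | smul a ha z _ =>
    rw [show tmulRight M (a • z) = a • tmulRight M z from map_smul _ _ _, extMap_smul,
      smul_ext_residueField ha]
  | add y _ z _ hy hz =>
    rw [show tmulRight M (y + z) = tmulRight M y + tmulRight M z from map_add _ _ _, extMap_add,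
      hy, hz, add_zero]

lemma mem_maximalIdeal_smul_top [Module.Free A F] [Module.Finite A F] {y : F}
    (h : ∀ c : F →ₗ[A] A, c y ∈ maximalIdeal A) : y ∈ maximalIdeal A • (⊤ : Submodule A F) := by
  let b := Module.Free.chooseBasis A F
  rw [← b.sum_repr y]
  exact Submodule.sum_mem _ fun t _ => Submodule.smul_mem_smul (h (b.coord t)) trivial

/-- A proper submodule of the dual of a finite free module lies in the annihilator, modulo the
maximal ideal, of some element outside `maximalIdeal A • ⊤`. -/
lemma exists_forall_apply_mem_maximalIdeal [Module.Free A F] [Module.Finite A F]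
    {U : Submodule A (Module.Dual A F)} (hU : U ≠ ⊤) :
    ∃ u : F, (∀ p ∈ U, p u ∈ maximalIdeal A) ∧ ∃ p : Module.Dual A F, IsUnit (p u) := by
  obtain h | ⟨V, hV, hUV⟩ := eq_top_or_exists_le_coatom U
  · exact absurd h hU
  have := isSimpleModule_iff_isCoatom.2 hV
  obtain ⟨I, hI, ⟨e⟩⟩ := isSimpleModule_iff_quot_maximal.1 this
  obtain rfl := eq_maximalIdeal hI
  let w : Module.Dual A F →ₗ[A] ResidueField A := e.toLinearMap ∘ₗ V.mkQ
  have hw (p) : w p = 0 ↔ p ∈ V :=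
    (map_eq_zero_iff e e.injective).trans (Submodule.Quotient.mk_eq_zero V)
  let b := Module.Free.chooseBasis A F
  choose c hc using fun t => residue_surjective (w (b.coord t))
  have key (p : Module.Dual A F) : residue A (p (∑ t, c t • b t)) = w p := by
    have hp : p = ∑ t, p (b t) • b.coord t := by
      refine b.ext fun s => ?_
      simp
    conv_rhs => rw [hp]
    rw [map_sum, map_sum, map_sum]
    refine Finset.sum_congr rfl fun t _ => ?_
    rw [LinearMap.map_smul p, LinearMap.map_smul w, ← hc, smul_eq_mul, map_mul, mul_comm]
    rfl
  refine ⟨∑ t, c t • b t, fun p hp => ?_, ?_⟩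
  · rw [← residue_eq_zero_iff, key, hw]
    exact hUV hp
  · obtain ⟨p, -, hp⟩ := SetLike.exists_of_lt hV.lt_top
    refine ⟨p, ?_⟩
    by_contra hpu
    exact hp ((hw p).1 (by rw [← key]; exact (residue_eq_zero_iff _).2 hpu))

/-- If `M ⊗ f` is injective on `Ext` from the residue field in degree `depth M`, then functionals
on the source of `f` factor through `f`. -/
lemma CoRes.exists_comp_eq (C : CoRes A) {d : ℕ}
    (hV : ∀ i, i < d → ExtVanishes A (ResidueField A) M i)
    (hd : ¬ ExtVanishes A (ResidueField A) M d) (hT : ∀ j, TorVanishes A M (C.G j) 1)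
    [Module.Free A F] [Module.Finite A F] (f : C.G 0 →ₗ[A] F)
    (hf : Function.Injective (extMap (ResidueField A) (f.lTensor M) d)) (a : C.G 0 →ₗ[A] A) :
    ∃ b : F →ₗ[A] A, b ∘ₗ f = a := by
  let U : Submodule A (Module.Dual A (C.P 0)) :=
    (LinearMap.range f.dualMap).comap (C.ι 0).dualMap
  suffices hU : U = ⊤ by
    obtain ⟨p, rfl⟩ := C.extend 0 a
    exact (hU ▸ Submodule.mem_top : p ∈ U)
  by_contra hU
  obtain ⟨u, hu, p, hp⟩ := exists_forall_apply_mem_maximalIdeal hU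
  obtain ⟨φ, rfl⟩ := exists_comp_eq_of_forall_functional (C.extend 0) f
  rw [ExtVanishes, not_subsingleton_iff_nontrivial] at hd
  obtain ⟨ξ, hξ⟩ := exists_ne (0 : Abelian.Ext (ModuleCat.of A (ResidueField A)) (ModuleCat.of A M) d)
  let η := extMap (ResidueField A) (tmulRight M u) d ξ
  have hη : η ≠ 0 := by
    intro (h0 : extMap (ResidueField A) (tmulRight M u) d ξ = 0)
    have h1 := extMap_comp (X := ResidueField A) (tmulRight M u) (tensorContract M p) d ξ
    rw [tensorContract_comp_tmulRight, extMap_smul, extMap_id, h0, map_zero, hp.smul_eq_zero] at h1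
    exact hξ h1
  have h1 : extMap (ResidueField A) ((C.π 0).lTensor M) d η = 0 := by
    refine (injective_iff_map_eq_zero _).1 ((C.ses 1).extMap_lTensor_injective (hT 2)
      fun i hi => C.extVanishes hV hT i 2 hi) _ ?_
    rw [← extMap_comp, ← extMap_comp, LinearMap.comp_assoc, lTensor_comp_tmulRight,
      lTensor_comp_tmulRight]
    refine extMap_tmulRight_eq_zero (mem_maximalIdeal_smul_top fun c => ?_) ξ
    refine hu (c ∘ₗ C.ι 1 ∘ₗ C.π 0) ⟨0, ?_⟩
    rw [map_zero]
    ext x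
    simp [(C.ses 0).exact.apply_apply_eq_zero]
  obtain ⟨y, hy⟩ := ((C.ses 0).lTensor (hT 1)).exists_extMap_left η h1
  have hy0 : y = 0 := by
    refine (injective_iff_map_eq_zero _).1 hf y ?_
    rw [LinearMap.lTensor_comp, extMap_comp, hy, ← extMap_comp, lTensor_comp_tmulRight]
    exact extMap_tmulRight_eq_zero (mem_maximalIdeal_smul_top fun c => hu (c ∘ₗ φ) ⟨c, rfl⟩) ξ
  rw [hy0, map_zero] at hy
  exact hη hy.symm

end

section

open TensorProduct

variable {A : Type u} [CommRing A] {X Y Z M F : Type u} [AddCommGroup X] [Module A X]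
  [AddCommGroup Y] [Module A Y] [AddCommGroup Z] [Module A Z] [AddCommGroup M] [Module A M]
  [AddCommGroup F] [Module A F]

lemma extMap_injective_of_comp_eq_id {f : Y →ₗ[A] Z} {g : Z →ₗ[A] Y} (h : g ∘ₗ f = LinearMap.id)
    (i : ℕ) : Function.Injective (extMap X f i) := by
  intro x y hxy
  rw [← extMap_id i x, ← extMap_id i y, ← h, extMap_comp, extMap_comp, hxy]

lemma extMap_lTensor_equiv_injective (e : Y ≃ₗ[A] Z) (i : ℕ) :
    Function.Injective (extMap X (e.toLinearMap.lTensor M) i) :=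
  extMap_injective_of_comp_eq_id (g := e.symm.toLinearMap.lTensor M)
    (by rw [← LinearMap.lTensor_comp, e.symm_comp, LinearMap.lTensor_id]) i

/-- `M` is `Tor`-independent of every term of a coresolution as soon as it is so of the first. -/
def TorPropagates (A : Type u) [CommRing A] (M : Type u) [AddCommGroup M] [Module A M] : Prop :=
  ∀ C : CoRes A, (∀ i, 0 < i → TorVanishes A M (C.G 0) i) →
    ∀ j i, 0 < i → TorVanishes A M (C.G j) i

lemma torVanishes_of_flat_left_of_pos [Module.Flat A M] {i : ℕ} (hi : 0 < i) :
    TorVanishes A M X i := by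
  obtain ⟨i, rfl⟩ := Nat.exists_eq_succ_of_ne_zero hi.ne'
  exact torVanishes_of_flat_left i

lemma torPropagates_of_flat [Module.Flat A M] : TorPropagates A M :=
  fun _ _ _ _ hi => torVanishes_of_flat_left_of_pos hi

lemma FreeSyz.extVanishes (R : FreeSyz A) {d : ℕ} (hV : ∀ i, i < d → ExtVanishes A X M i)
    (hT : ∀ j, TorVanishes A M (R.Z j) 1) (i : ℕ) :
    ∀ m, i < m → i < d → ExtVanishes A X (M ⊗[A] R.Z m) i := by
  induction i with
  | zero =>
    intro m hm hi
    obtain ⟨m, rfl⟩ := Nat.exists_eq_succ_of_ne_zero hm.ne'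
    have : Subsingleton (Abelian.Ext (ModuleCat.of A X) (ModuleCat.of A (M ⊗[A] R.F m)) 0) :=
      (hV 0 hi).tensor_free
    exact (extMap_zero_injective (X := X) ((R.ses m).lTensor (hT m)).inj).subsingleton
  | succ i ih =>
    intro m hm hi
    obtain ⟨m, rfl⟩ := Nat.exists_eq_succ_of_ne_zero (Nat.ne_zero_of_lt hm)
    exact ((R.ses m).lTensor (hT m)).cov_left (ih m (by omega) (by omega)) (hV _ hi).tensor_free

namespace DualAcyclic

variable [IsNoetherianRing A] [Module.Finite A X]

lemma extMap_lTensor_injective (hX : DualAcyclic A X) {d : ℕ}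
    (hV : ∀ i, i < d → ExtVanishes A Z M i) (hM : TorPropagates A M)
    (hT : ∀ i, 0 < i → TorVanishes A M X i) {f : X →ₗ[A] Y}
    (hf : ∀ a : X →ₗ[A] A, ∃ b : Y →ₗ[A] A, b ∘ₗ f = a) :
    Function.Injective (extMap Z (f.lTensor M) d) := by
  obtain ⟨C, ⟨e⟩⟩ := hX.exists_coRes
  have hC := hM C fun i hi => (hT i hi).congr_left e
  obtain ⟨ψ, hψ⟩ := exists_comp_eq_of_forall_functional hf (C.ι 0 ∘ₗ e.toLinearMap)
  refine extMap_lTensor_injective_of_factor hψ ?_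
  intro x y hxy
  rw [LinearMap.lTensor_comp, extMap_comp, extMap_comp] at hxy
  exact extMap_lTensor_equiv_injective e d ((C.ses 0).extMap_lTensor_injective (hC 1 1 one_pos)
    (fun i hi => C.extVanishes hV (fun j => hC j 1 one_pos) i 1 hi) hxy)

lemma exists_comp_eq [IsLocalRing A] (hX : DualAcyclic A X) {d : ℕ}
    (hV : ∀ i, i < d → ExtVanishes A (ResidueField A) M i)
    (hd : ¬ ExtVanishes A (ResidueField A) M d) (hM : TorPropagates A M)
    (hT : ∀ i, 0 < i → TorVanishes A M X i) [Module.Free A F] [Module.Finite A F] {f : X →ₗ[A] F}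
    (hf : Function.Injective (extMap (ResidueField A) (f.lTensor M) d)) (a : X →ₗ[A] A) :
    ∃ b : F →ₗ[A] A, b ∘ₗ f = a := by
  obtain ⟨C, ⟨e⟩⟩ := hX.exists_coRes
  have hC := hM C fun i hi => (hT i hi).congr_left e
  obtain ⟨b, hb⟩ := C.exists_comp_eq hV hd (fun j => hC j 1 one_pos) (f ∘ₗ e.symm.toLinearMap)
    (by
      intro x y hxy
      rw [LinearMap.lTensor_comp, extMap_comp, extMap_comp] at hxy
      exact extMap_lTensor_equiv_injective e.symm d (hf hxy))
    (a ∘ₗ e.symm.toLinearMap)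
  refine ⟨b, LinearMap.ext fun x => ?_⟩
  simpa using LinearMap.congr_fun hb (e x)

end DualAcyclic

namespace FreeSyz

variable [IsNoetherianRing A] [IsLocalRing A] {R : FreeSyz A} {d : ℕ}

/-- Over a local ring of depth `d`, the `d`-th syzygies of a module of finite Gorenstein dimension
have acyclic dual. -/
lemma dualAcyclic (hA : ∀ i, i < d → ExtVanishes A (ResidueField A) A i)
    (hAd : ¬ ExtVanishes A (ResidueField A) A d) {n : ℕ} (h : HasGLength A n (R.Z 0)) {m : ℕ}
    (hm : d ≤ m) : DualAcyclic A (R.Z m) := by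
  have key : ∀ j m, d ≤ m → n ≤ m + j → DualAcyclic A (R.Z m) := by
    intro j
    induction j with
    | zero => exact fun m _ hn => (R.totallyReflexive h hn).toDualAcyclic
    | succ j ih =>
      intro m hm hn
      have hZ := ih (m + 1) (by omega) (by omega)
      have hinj := (R.ses m).extMap_lTensor_injective (M := A) (i := d)
        (torVanishes_of_flat_left 0) fun i hi =>
          R.extVanishes hA (fun j => torVanishes_of_flat_left 0) i m (by omega) hi
      exact (R.ses m).dualAcyclic_right
        (hZ.exists_comp_eq hA hAd torPropagates_of_flat
          (fun _ hi => torVanishes_of_flat_left_of_pos hi) hinj)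
        hZ (totallyReflexive_of_projective).toDualAcyclic
  exact key n m hm (by omega)

lemma extVanishes_residueField_zero (hA : ∀ i, i < d → ExtVanishes A (ResidueField A) A i)
    (hAd : ¬ ExtVanishes A (ResidueField A) A d)
    (hV : ∀ i, i < d → ExtVanishes A (ResidueField A) M i)
    (hd : ¬ ExtVanishes A (ResidueField A) M d) (hM : TorPropagates A M)
    (hT : ∀ i, 0 < i → TorVanishes A M (R.Z 0) i) {n : ℕ} (h : HasGLength A n (R.Z 0))
    (h0 : ExtVanishes A (ResidueField A) (M ⊗[A] R.Z 0) 0) :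
    ExtVanishes A (ResidueField A) (R.Z 0) 0 := by
  have hTZ := R.torVanishes hT
  have hZ := dualAcyclic hA hAd h le_rfl
  refine ExtVanishes.congr_right (TensorProduct.lid A (R.Z 0)) ?_
  cases d with
  | zero =>
    have hinj : Function.Injective
        (extMap (ResidueField A) ((0 : R.Z 0 →ₗ[A] PUnit.{u + 1}).lTensor M) 0) := by
      have : Subsingleton _ := h0
      exact Function.injective_of_subsingleton _
    have := hZ.extMap_lTensor_injective hA torPropagates_of_flat
      (fun _ hi => torVanishes_of_flat_left_of_pos hi)
      (hZ.exists_comp_eq hV hd hM hT hinj)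
    refine subsingleton_of_forall_eq 0 fun x => this ?_
    rw [LinearMap.lTensor_zero, extMap_zero, extMap_zero]
  | succ d =>
    have hMZ : ∀ i, i ≤ d → ExtVanishes A (ResidueField A) (M ⊗[A] R.Z i) i := by
      intro i
      induction i with
      | zero => exact fun _ => h0
      | succ i ih =>
        exact fun hi => ((R.ses i).lTensor (hTZ i 1 one_pos)).cov_left (ih (by omega))
          (hV _ (by omega)).tensor_free
    have hAZ : ∀ j i, i + j = d → ExtVanishes A (ResidueField A) (A ⊗[A] R.Z i) i := by
      intro j
      induction j with
      | zero =>
        rintro i rfl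
        have hs := (R.ses i).lTensor (M := A) (torVanishes_of_flat_left 0)
        have hinj := ((R.ses i).lTensor (hTZ i 1 one_pos)).extMap_injective_succ (hMZ i le_rfl)
        exact hs.vanishes_of_extMap_injective (hA i i.lt_succ_self).tensor_free
          (hZ.extMap_lTensor_injective hA torPropagates_of_flat
            (fun _ hi => torVanishes_of_flat_left_of_pos hi)
            (hZ.exists_comp_eq hV hd hM (hTZ _) hinj))
      | succ j ih =>
        intro i hi
        exact ((R.ses i).lTensor (M := A) (torVanishes_of_flat_left 0)).cov_right
          (hA i (by omega)).tensor_free (ih (i + 1) (by omega))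
    exact hAZ d 0 (zero_add d)

end FreeSyz

end

section

variable {A : Type u} [CommRing A] [IsLocalRing A] {M : Type u}
  [AddCommGroup M] [Module A M] [Module.Finite A M]

lemma support_residueField :
    Module.support A (ModuleCat.of A (ResidueField A)) =
      PrimeSpectrum.zeroLocus (maximalIdeal A : Set A) := by
  change Module.support A (A ⧸ maximalIdeal A) = _
  rw [Module.support_eq_zeroLocus, Ideal.annihilator_quotient]

lemma maximalIdeal_smul_top_lt_top [Nontrivial M] :
    maximalIdeal A • (⊤ : Submodule A M) < ⊤ :=
  (Submodule.top_ne_ideal_smul_of_le_jacobson_annihilator (maximalIdeal_le_jacobson _)).symm.lt_top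

variable [IsNoetherianRing A]

lemma extVanishes_of_lt_moduleDepth {i : ℕ} (h : (i : ℕ∞) < moduleDepth A M) :
    ExtVanishes A (ResidueField A) M i := by
  obtain ⟨_, ⟨rs, rfl, hrs, hreg⟩, hi⟩ := lt_sSup_iff.1 h
  have := hreg.nontrivial
  have : Module.Finite A (ModuleCat.of A (ResidueField A)) :=
    inferInstanceAs (Module.Finite A (A ⧸ maximalIdeal A))
  exact ModuleCat.subsingleton_ext_of_exists_isRegular (maximalIdeal A) _
    support_residueField.subset (ModuleCat.of A M) maximalIdeal_smul_top_lt_top rs hrs hreg i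
    (by exact_mod_cast hi)

lemma le_moduleDepth [Nontrivial M] {n : ℕ}
    (h : ∀ i, i < n → ExtVanishes A (ResidueField A) M i) : (n : ℕ∞) ≤ moduleDepth A M := by
  have : Module.Finite A (ModuleCat.of A (ResidueField A)) :=
    inferInstanceAs (Module.Finite A (A ⧸ maximalIdeal A))
  obtain ⟨rs, hl, hrs, hreg⟩ := ModuleCat.exists_isRegular_of_exists_subsingleton_ext
    (maximalIdeal A) n (ModuleCat.of A M) maximalIdeal_smul_top_lt_top _ support_residueField h
  exact le_sSup ⟨rs, by rw [hl], hrs, hreg⟩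

lemma not_extVanishes_of_moduleDepth_eq [Nontrivial M] {d : ℕ} (h : moduleDepth A M = d) :
    ¬ ExtVanishes A (ResidueField A) M d := by
  intro hd
  have := le_moduleDepth (A := A) (M := M) (n := d + 1) fun i hi => by
    obtain hi | rfl := Nat.lt_succ_iff_lt_or_eq.1 hi
    · exact extVanishes_of_lt_moduleDepth (by rw [h]; exact_mod_cast hi)
    · exact hd
  rw [h] at this
  exact absurd (by exact_mod_cast this) (Nat.not_succ_le_self d)

end

/-- **Proposition 3.2.** Let `A` be a Cohen-Macaulay local ring and `M`, `N` nonzero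
finitely generated Tor-independent `A`-modules. Assume `M` is maximal Cohen-Macaulay with
reducible complexity, and `N` has finite Gorenstein dimension. If `depth (M ⊗ N) > 0`
then `depth N > 0`. -/
theorem depth_pos_of_tensor_depth_pos (A : Type u) [CommRing A] [IsNoetherianRing A]
    [IsLocalRing A] (hCM : IsCMLocalRing A)
    (M N : Type u) [AddCommGroup M] [Module A M] [AddCommGroup N] [Module A N]
    [Module.Finite A M] [Module.Finite A N]
    (hM : Nontrivial M) (hN : Nontrivial N)
    (hTor : TorIndep A M N)
    (hMCM : IsMaxCM A M) (hred : HasReducibleComplexity A M)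
    (hGdim : HasFiniteGDim A N)
    (hpos : 0 < moduleDepth A (TensorProduct A M N)) :
    0 < moduleDepth A N := by
  obtain ⟨d, hAd⟩ : ∃ d : ℕ, moduleDepth A A = d := by
    refine ⟨_, (ENat.natCast_toNat fun htop => ?_).symm⟩
    have h : (moduleDepth A A : WithBot ℕ∞) = ringKrullDim A := hCM
    rw [htop] at h
    exact ringKrullDim_ne_top h.symm
  have hMd : moduleDepth A M = d := by
    rw [← hAd]
    exact WithBot.coe_injective (hMCM.trans hCM.symm)
  have hfin : Module.Finite A (ModuleCat.of A N) := inferInstanceAs (Module.Finite A N)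
  obtain ⟨R, hR⟩ := exists_freeSyz (ModuleCat.of A N)
  obtain ⟨D, hD⟩ := hGdim
  obtain ⟨n, hn⟩ := D.hasResLength (P := fun X => TotallyReflexive A X)
    (fun X _ => totallyReflexive_of_projective) fun n => (hD n).totallyReflexive
  have h0 := extVanishes_of_lt_moduleDepth (i := 0) hpos
  have hT (i : ℕ) (hi : 0 < i) : TorVanishes A M N i :=
    torVanishes_of_subsingleton_torModule hi (hTor i hi)
  have key := R.extVanishes_residueField_zero (d := d) (M := M) (n := n)
    (fun i hi => extVanishes_of_lt_moduleDepth (by rw [hAd]; exact_mod_cast hi))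
    (not_extVanishes_of_moduleDepth_eq hAd)
    (fun i hi => extVanishes_of_lt_moduleDepth (by rw [hMd]; exact_mod_cast hi))
    (not_extVanishes_of_moduleDepth_eq hMd)
    (fun C hC => HasRedCxCat.torVanishes_coRes hred C hC)
    (by rw [hR]; exact hT) (by rw [hR]; exact hn) (by rw [hR]; exact h0)
  rw [hR] at key
  have := le_moduleDepth (A := A) (M := N) (n := 1) fun i hi => by
    obtain rfl := Nat.lt_one_iff.1 hi
    exact key
  exact lt_of_lt_of_le (by simp) this

end
end
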